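/- arXiv:math/0210079 — 3 statements merged into one kernel-verified Lean document; each statement's English description precedes it below -/
import Mathlib

section
/- Let I be a homogeneous ideal of S = k[x_1,…,x_n], let R = S/I, and let z_1,…,z_{t+1} be a filter-regular sequence of linear forms in R. Then: (i) reg_t(R) is the largest integer r for which there exists an index 0 ≤ i ≤ t such that the degree-r graded piece of the colon ideal ((z_1,…,z_i) : z_{i+1}) in R differs from the degree-r graded piece of (z_1,…,z_i); (ii) a*_t(R) is the largest integer a for which there exists an index 0 ≤ i ≤ t such that the degree-(a+i) graded piece of ((z_1,…,z_i) : z_{i+1}) differs from the degree-(a+i) graded piece of (z_1,…,z_i). -/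
set_option synthInstance.maxHeartbeats 1000000
set_option maxHeartbeats 1000000

/-! Common definitions: gradings, term orders, initial ideals, generic initial ideals,
Borel-fixed ideals, filter-regular sequences, a Koszul/Čech-type description of graded
local cohomology and the invariants `a_i`, `reg_t`, `a*_t`, minimal graded free
resolutions, and reductions. -/

namespace Paper

open MvPolynomial

noncomputable section

variable {k : Type*} [Field k] {n : ℕ}

/-- Total degree of an exponent vector. -/
def adeg (a : Fin n →₀ ℕ) : ℕ := ∑ j, a j

/-- `m(x^A)` : the largest (1-based) index `i` such that `xᵢ` divides `x^A`. -/
def mval (a : Fin n →₀ ℕ) : ℕ := a.support.sup fun j => (j : ℕ) + 1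

/-- The degree-`d` homogeneous piece of the polynomial ring (`⊥` in negative degrees). -/
def sPiece (k : Type*) [Field k] (n : ℕ) (d : ℤ) : Submodule k (MvPolynomial (Fin n) k) :=
  if 0 ≤ d then homogeneousSubmodule (Fin n) k d.toNat else ⊥

/-- `I` is a homogeneous (graded) ideal. -/
def IsHomog (I : Ideal (MvPolynomial (Fin n) k)) : Prop :=
  ∀ f ∈ I, ∀ d : ℕ, homogeneousComponent d f ∈ I

/-- Degree reverse lexicographic order with `x₁ > x₂ > ⋯ > xₙ` : `a < b`. -/
def drlt (a b : Fin n →₀ ℕ) : Prop :=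
  adeg a < adeg b ∨
    (adeg a = adeg b ∧ ∃ i : Fin n, b i < a i ∧ ∀ j : Fin n, i < j → a j = b j)

/-- Lexicographic order with `x₁ > x₂ > ⋯ > xₙ` : `a < b`. -/
def lexlt (a b : Fin n →₀ ℕ) : Prop :=
  ∃ i : Fin n, a i < b i ∧ ∀ j : Fin n, j < i → a j = b j

/-- An abstract term order on monomials in `n` variables. -/
structure TermOrder (n : ℕ) where
  lt : (Fin n →₀ ℕ) → (Fin n →₀ ℕ) → Prop
  irrefl : ∀ a, ¬ lt a a
  trans : ∀ a b c, lt a b → lt b c → lt a c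
  total : ∀ a b, a ≠ b → lt a b ∨ lt b a
  add_right : ∀ a b c, lt a b → lt (a + c) (b + c)
  zero_bot : ∀ a, a ≠ 0 → lt 0 a

/-- `a` is the leading exponent of `f` with respect to the term order `lt`. -/
def IsLeadExp (lt : (Fin n →₀ ℕ) → (Fin n →₀ ℕ) → Prop)
    (f : MvPolynomial (Fin n) k) (a : Fin n →₀ ℕ) : Prop :=
  a ∈ f.support ∧ ∀ b ∈ f.support, b ≠ a → lt b a

/-- The initial ideal of `I` with respect to the term order `lt`. -/
def inIdealW (lt : (Fin n →₀ ℕ) → (Fin n →₀ ℕ) → Prop)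
    (I : Ideal (MvPolynomial (Fin n) k)) : Ideal (MvPolynomial (Fin n) k) :=
  Ideal.span {m | ∃ f a, f ∈ I ∧ IsLeadExp lt f a ∧ m = monomial a (1 : k)}

/-- The initial ideal with respect to the (degree) reverse lexicographic order. -/
def inIdeal (I : Ideal (MvPolynomial (Fin n) k)) : Ideal (MvPolynomial (Fin n) k) :=
  inIdealW drlt I

/-- The linear change of coordinates associated to a matrix `g`, `xⱼ ↦ ∑ᵢ gᵢⱼ xᵢ`. -/
def act (g : Matrix (Fin n) (Fin n) k) :
    MvPolynomial (Fin n) k →ₐ[k] MvPolynomial (Fin n) k :=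
  aeval fun j => ∑ i, C (g i j) * X i

/-- The image of the ideal `I` under the linear change of coordinates `g`. -/
def actI (g : Matrix (Fin n) (Fin n) k) (I : Ideal (MvPolynomial (Fin n) k)) :
    Ideal (MvPolynomial (Fin n) k) :=
  Ideal.map (act g) I

/-- `J` is the generic initial ideal of `I` w.r.t. the term order `lt`:
there is a nonempty Zariski-open subset `U ⊆ GL(n,k)` with `in(g I) = J` for all `g ∈ U`. -/
def IsGinW (lt : (Fin n →₀ ℕ) → (Fin n →₀ ℕ) → Prop)
    (I J : Ideal (MvPolynomial (Fin n) k)) : Prop :=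
  ∃ U : Set (Matrix (Fin n) (Fin n) k), U.Nonempty ∧
    (∃ P : Set (MvPolynomial (Fin n × Fin n) k),
      U = {g | IsUnit g.det ∧ ∃ p ∈ P, MvPolynomial.eval (fun q => g q.1 q.2) p ≠ 0}) ∧
    ∀ g ∈ U, inIdealW lt (actI g I) = J

/-- Generic initial ideal with respect to the reverse lexicographic order. -/
def IsGin (I J : Ideal (MvPolynomial (Fin n) k)) : Prop := IsGinW drlt I J

/-- `I` is a monomial ideal. -/
def IsMonomialIdeal (I : Ideal (MvPolynomial (Fin n) k)) : Prop :=
  ∃ A : Set (Fin n →₀ ℕ), I = Ideal.span ((fun a => (monomial a (1 : k))) '' A)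

/-- The maximal graded ideal `𝔐 = (x₁, …, xₙ)` of the polynomial ring. -/
def maxIdeal (k : Type*) [Field k] (n : ℕ) : Ideal (MvPolynomial (Fin n) k) :=
  Ideal.span (Set.range X)

/-- `x^a` is a minimal (monomial) generator of the monomial ideal `I`. -/
def IsMinGen (I : Ideal (MvPolynomial (Fin n) k)) (a : Fin n →₀ ℕ) : Prop :=
  monomial a (1 : k) ∈ I ∧ monomial a (1 : k) ∉ maxIdeal k n * I

def IsUpperTriangular (g : Matrix (Fin n) (Fin n) k) : Prop :=
  ∀ i j : Fin n, j < i → g i j = 0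

/-- `I` is Borel-fixed: fixed by every invertible upper triangular change of coordinates. -/
def IsBorelFixed (I : Ideal (MvPolynomial (Fin n) k)) : Prop :=
  ∀ g : Matrix (Fin n) (Fin n) k, IsUnit g.det → IsUpperTriangular g → actI g I = I

/-- Degree-`d` piece of the standard grading on `S/I` (for `I` homogeneous). -/
def qPiece (I : Ideal (MvPolynomial (Fin n) k)) (d : ℤ) :
    Submodule k (MvPolynomial (Fin n) k ⧸ I) :=
  (sPiece k n d).map (Ideal.Quotient.mkₐ k I).toLinearMap

/-- Degree-`d` piece of the standard grading on the ideal `I` viewed as a module. -/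
def iPiece (I : Ideal (MvPolynomial (Fin n) k)) (d : ℤ) : Submodule k ↥I :=
  (sPiece k n d).comap ((I.subtype).restrictScalars k)

/-- The maximal graded ideal of `S/I`. -/
def maxIdealQ (I : Ideal (MvPolynomial (Fin n) k)) : Ideal (MvPolynomial (Fin n) k ⧸ I) :=
  (maxIdeal k n).map (Ideal.Quotient.mk I)

/-- `z 0, …, z (s-1)` is a filter-regular sequence in `R` (with maximal graded ideal `mR`):
`z i` avoids all associated primes `≠ mR` of `(z 0, …, z (i-1))`. -/
def FilterRegular {R : Type*} [CommRing R] (mR : Ideal R) (z : ℕ → R) (s : ℕ) : Prop :=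
  ∀ i < s, ∀ p ∈ associatedPrimes R (R ⧸ Ideal.span {x | ∃ j < i, x = z j}),
    p ≠ mR → z i ∉ p

/-- The sequence `xₙ, xₙ₋₁, …, x₁` in `S/I` (extended by `0`). -/
def revVars (I : Ideal (MvPolynomial (Fin n) k)) (j : ℕ) :
    MvPolynomial (Fin n) k ⧸ I :=
  if h : j < n then Ideal.Quotient.mk I (X ⟨n - 1 - j, by omega⟩) else 0

section LC

variable {M : Type*} [AddCommGroup M]

/-- `i`-cochains of the stable Koszul (Čech) complex on the variables. -/
abbrev Koch (n : ℕ) (M : Type*) (i : ℕ) : Type _ :=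
  {T : Finset (Fin n) // T.card = i} → M

/-- The differential (into cohomological degree `i`) of the Koszul complex
on `x₁ᵗ, …, xₙᵗ` with coefficients in `M`. -/
def kdelta [Module (MvPolynomial (Fin n) k) M] (t i : ℕ)
    (v : Koch n M (i - 1)) : Koch n M i := fun T =>
  ∑ j ∈ T.1.attach,
    ((-1 : ℤ) ^ ((T.1.filter (fun l => l < j.1)).card)) •
      ((X j.1 ^ t : MvPolynomial (Fin n) k) •
        v ⟨T.1.erase j.1, by rw [Finset.card_erase_of_mem j.2, T.2]⟩)

/-- The transition map from the Koszul complex at level `t` to the one at level `t+1`. -/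
def ktrans [Module (MvPolynomial (Fin n) k) M] (i : ℕ) (v : Koch n M i) : Koch n M i :=
  fun T => ((∏ j ∈ T.1, X j : MvPolynomial (Fin n) k)) • v T

/-- The cochain `v` lies in the degree-`d` strand (for the grading `ℳ` of `M`,
where the Koszul generators at level `t` have degree `t`). -/
def strand [Module k M] (ℳ : ℤ → Submodule k M) (t i : ℕ) (d : ℤ)
    (v : Koch n M i) : Prop :=
  ∀ T, v T ∈ ℳ (d + (t : ℤ) * (i : ℤ))

/-- `H^i_𝔐(M)_d ≠ 0` : the degree-`d` strand of `i`-th local cohomology (computed as the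
direct limit over `t` of the Koszul cohomology on `x₁ᵗ, …, xₙᵗ`) is nonzero. -/
def lcNonvanish (n : ℕ) [Module k M] [Module (MvPolynomial (Fin n) k) M]
    (ℳ : ℤ → Submodule k M) (i : ℕ) (d : ℤ) : Prop :=
  ∃ (t : ℕ) (v : Koch n M i),
    strand ℳ t i d v ∧ kdelta (k := k) t (i + 1) v = 0 ∧
    ∀ s : ℕ, ¬ ∃ w : Koch n M (i - 1),
      strand ℳ (t + s) (i - 1) d w ∧
        kdelta (k := k) (t + s) i w = (ktrans (k := k) i)^[s] v

open Classical in
/-- `a_i(M)` : the largest degree `d` with `H^i_𝔐(M)_d ≠ 0` (`⊥` if `H^i_𝔐(M) = 0`). -/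
def aDeg (n : ℕ) [Module k M] [Module (MvPolynomial (Fin n) k) M]
    (ℳ : ℤ → Submodule k M) (i : ℕ) : WithBot ℤ :=
  if (∃ d : ℤ, lcNonvanish n ℳ i d) then
    ((sSup {d : ℤ | lcNonvanish n ℳ i d} : ℤ) : WithBot ℤ)
  else ⊥

/-- `reg_t(M) = max{a_i(M) + i : i ≤ t}`. -/
def regT (n : ℕ) [Module k M] [Module (MvPolynomial (Fin n) k) M]
    (ℳ : ℤ → Submodule k M) (t : ℕ) : WithBot ℤ :=
  (Finset.range (t + 1)).sup fun i => aDeg n ℳ i + ((i : ℤ) : WithBot ℤ)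

/-- `a*_t(M) = max{a_i(M) : i ≤ t}`. -/
def aStarT (n : ℕ) [Module k M] [Module (MvPolynomial (Fin n) k) M]
    (ℳ : ℤ → Submodule k M) (t : ℕ) : WithBot ℤ :=
  (Finset.range (t + 1)).sup fun i => aDeg n ℳ i

end LC

open Classical in
/-- Supremum of a set of integers, as an element of `WithBot ℤ` (`⊥` for the empty set). -/
def zSupBot (A : Set ℤ) : WithBot ℤ :=
  if A.Nonempty then ((sSup A : ℤ) : WithBot ℤ) else ⊥

section Res

variable (k) (n)
variable (M : Type*) [AddCommGroup M] [Module k M]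
  [Module (MvPolynomial (Fin n) k) M]

/-- A minimal graded free resolution `0 → F_len → ⋯ → F_1 → F_0 → M` of the graded
module `M` (with grading `ℳ`): `F i` is free with basis elements of degrees `tw i j`,
the maps are degree-preserving, the complex is exact, and all differentials map into
`𝔐 ⬝ F i` (minimality). -/
structure MGFR (ℳ : ℤ → Submodule k M) where
  len : ℕ
  rk : ℕ → ℕ
  tw : (i : ℕ) → Fin (rk i) → ℤ
  rk_top : ∀ i, len < i → rk i = 0
  aug : (Fin (rk 0) → MvPolynomial (Fin n) k) →ₗ[MvPolynomial (Fin n) k] M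
  diff : (i : ℕ) → ((Fin (rk (i + 1)) → MvPolynomial (Fin n) k)
      →ₗ[MvPolynomial (Fin n) k] (Fin (rk i) → MvPolynomial (Fin n) k))
  aug_surj : Function.Surjective aug
  exact_zero : LinearMap.ker aug = LinearMap.range (diff 0)
  exact_succ : ∀ i, LinearMap.ker (diff i) = LinearMap.range (diff (i + 1))
  graded_aug : ∀ (d : ℤ) (v : Fin (rk 0) → MvPolynomial (Fin n) k),
    (∀ j, v j ∈ sPiece k n (d - tw 0 j)) → aug v ∈ ℳ d
  graded_diff : ∀ (i : ℕ) (d : ℤ) (v : Fin (rk (i + 1)) → MvPolynomial (Fin n) k),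
    (∀ j, v j ∈ sPiece k n (d - tw (i + 1) j)) → ∀ j, diff i v j ∈ sPiece k n (d - tw i j)
  minimal : ∀ i, LinearMap.range (diff i) ≤
    (maxIdeal k n) • (⊤ : Submodule (MvPolynomial (Fin n) k)
      (Fin (rk i) → MvPolynomial (Fin n) k))

variable {k n M} {ℳ : ℤ → Submodule k M}

/-- `b_i` : the maximum degree of the generators of `F_i` (`⊥` if `F_i = 0`). -/
def bdeg (res : MGFR k n M ℳ) (i : ℕ) : WithBot ℤ :=
  Finset.univ.sup fun j : Fin (res.rk i) => ((res.tw i j : ℤ) : WithBot ℤ)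

/-- The `j`-th syzygy module of `M`, as a submodule of `F_j`. -/
def syzSub (res : MGFR k n M ℳ) : (j : ℕ) →
    Submodule (MvPolynomial (Fin n) k) (Fin (res.rk j) → MvPolynomial (Fin n) k)
  | 0 => LinearMap.ker res.aug
  | (m + 1) => LinearMap.ker (res.diff m)

/-- The degree-`d` piece of the induced grading on the `j`-th syzygy module. -/
def syzPiece (res : MGFR k n M ℳ) (j : ℕ) (d : ℤ) :
    Submodule k ↥(syzSub res j) :=
  Submodule.comap ((syzSub res j).subtype.restrictScalars k)
    (Submodule.pi Set.univ fun l => sPiece k n (d - res.tw j l))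

/-- The dual (transposed) differential, into cohomological degree `i`,
of the complex `Hom(F_•, S)` computing `Ext^•(M, S)`. -/
def extDiffInto (res : MGFR k n M ℳ) : (i : ℕ) →
    (Fin (res.rk (i - 1)) → MvPolynomial (Fin n) k) →
      (Fin (res.rk i) → MvPolynomial (Fin n) k)
  | 0 => fun _ => 0
  | (m + 1) => fun u j' => ∑ j, res.diff m (Pi.single j' 1) j * u j

/-- `Ext^i_S(M, S)_r ≠ 0`, computed from the given minimal graded free resolution;
the dual basis element of a generator of degree `tw i j` has degree `-tw i j`. -/
def ExtNonzero (res : MGFR k n M ℳ) (i : ℕ) (r : ℤ) : Prop :=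
  ∃ u : Fin (res.rk i) → MvPolynomial (Fin n) k,
    (∀ j, u j ∈ sPiece k n (r + res.tw i j)) ∧
    extDiffInto res (i + 1) u = 0 ∧
    ¬ ∃ w : Fin (res.rk (i - 1)) → MvPolynomial (Fin n) k, extDiffInto res i w = u

end Res

section Red

variable {R : Type*} [CommRing R]

/-- `a` is a reduction of the ideal `mR` : `mR^(r+1) = a * mR^r` for all large `r`. -/
def IsReduction (mR a : Ideal R) : Prop :=
  a ≤ mR ∧ ∃ N, ∀ r ≥ N, mR ^ (r + 1) = a * mR ^ r

/-- `a` is a minimal reduction of `mR`. -/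
def IsMinimalReduction (mR a : Ideal R) : Prop :=
  IsReduction mR a ∧ ∀ b, IsReduction mR b → b ≤ a → b = a

/-- The reduction number `r_a` : the least `r` with `mR^(r+1) = a * mR^r`. -/
def redNum (mR a : Ideal R) : ℕ := sInf {r | mR ^ (r + 1) = a * mR ^ r}

/-- The reduction number: the minimum of `r_a` over all minimal reductions `a` of `mR`. -/
def ringRedNum (mR : Ideal R) : ℕ :=
  sInf {r | ∃ a, IsMinimalReduction mR a ∧ redNum mR a = r}

end Red


/-! ### Total Koszul cochains with polynomial coefficients -/

section Aux

/-- Exponent of the Koszul sign. -/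
def sg (j : Fin n) (T : Finset (Fin n)) : ℕ := (T.filter (fun l => l < j)).card

lemma sg_erase (j l : Fin n) (T : Finset (Fin n)) (hj : j ∈ T) :
    sg l (T.erase j) + (if j < l then 1 else 0) = sg l T := by
  unfold sg
  rw [Finset.filter_erase]
  split_ifs with h
  · have : j ∈ T.filter (fun x => x < l) := by simp [hj, h]
    exact Finset.card_erase_add_one this
  · rw [Finset.erase_eq_of_notMem]
    · simp
    · simp [h]

lemma sg_swap {A : Type*} [CommRing A] (j l : Fin n) (T : Finset (Fin n)) (hj : j ∈ T) (hl : l ∈ T)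
    (h : l ≠ j) :
    ((-1 : A) ^ sg j T) * (-1) ^ sg l (T.erase j) =
      -((-1 : A) ^ sg l T * (-1) ^ sg j (T.erase l)) := by
  have h1 := sg_erase j l T hj
  have h2 := sg_erase l j T hl
  rcases lt_or_gt_of_ne h with h3 | h3
  · rw [if_neg (by exact not_lt.2 h3.le)] at h1
    rw [if_pos h3] at h2
    rw [← h1, ← h2]
    ring
  · rw [if_pos h3] at h1
    rw [if_neg (by exact not_lt.2 h3.le)] at h2
    rw [← h1, ← h2]
    ring

/-- Cochains. -/
abbrev Coc (k : Type*) [Field k] (n : ℕ) := Finset (Fin n) → MvPolynomial (Fin n) k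

/-- Total Koszul differential. -/
def del (t : ℕ) (F : Coc k n) : Coc k n := fun T =>
  ∑ j ∈ T, (-1) ^ sg j T * (X j ^ t * F (T.erase j))

/-- Transition map. -/
def tau (s : ℕ) (F : Coc k n) : Coc k n := fun T => (∏ j ∈ T, X j) ^ s * F T

/-- Contracting homotopy. -/
def hot (a : Fin n) (F : Coc k n) : Coc k n := fun T =>
  if a ∈ T then 0 else (-1) ^ sg a T * F (insert a T)

lemma del_add (t : ℕ) (F G : Coc k n) : del t (F + G) = del t F + del t G := by
  funext T
  simp only [del, Pi.add_apply, ← Finset.sum_add_distrib]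
  exact Finset.sum_congr rfl fun j _ => by ring

lemma del_sub (t : ℕ) (F G : Coc k n) : del t (F - G) = del t F - del t G := by
  funext T
  simp only [del, Pi.sub_apply, ← Finset.sum_sub_distrib]
  exact Finset.sum_congr rfl fun j _ => by ring

lemma del_smul (t : ℕ) (c : MvPolynomial (Fin n) k) (F : Coc k n) :
    del t (c • F) = c • del t F := by
  funext T
  simp only [del, Pi.smul_apply, smul_eq_mul, Finset.mul_sum]
  exact Finset.sum_congr rfl fun j _ => by ring

lemma del_zero (t : ℕ) : del t (0 : Coc k n) = 0 := by
  funext T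
  simp [del]

lemma del_mem (J : Ideal (MvPolynomial (Fin n) k)) (t : ℕ) (F : Coc k n) (h : ∀ T, F T ∈ J) (T) :
    del t F T ∈ J :=
  J.sum_mem fun _ _ => J.mul_mem_left _ (J.mul_mem_left _ (h _))

lemma del_tau (t s : ℕ) (F : Coc k n) : del (t + s) (tau s F) = tau s (del t F) := by
  funext T
  simp only [del, tau, Finset.mul_sum]
  refine Finset.sum_congr rfl fun j hj => ?_
  rw [← Finset.mul_prod_erase T _ hj]
  ring

lemma tau_tau (s s' : ℕ) (F : Coc k n) : tau s (tau s' F) = tau (s' + s) F := by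
  funext T
  simp only [tau]
  ring

lemma tau_zero (F : Coc k n) : tau 0 F = F := by
  funext T
  simp [tau]

lemma tau_sub (s : ℕ) (F G : Coc k n) : tau s (F - G) = tau s F - tau s G := by
  funext T
  simp only [tau, Pi.sub_apply]
  ring

lemma tau_smul (s : ℕ) (c : MvPolynomial (Fin n) k) (F : Coc k n) :
    tau s (c • F) = c • tau s F := by
  funext T
  simp only [tau, Pi.smul_apply, smul_eq_mul]
  ring

lemma tau_mem (J : Ideal (MvPolynomial (Fin n) k)) (s : ℕ) (F : Coc k n) (h : ∀ T, F T ∈ J) (T) :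
    tau s F T ∈ J := J.mul_mem_left _ (h _)

lemma del_del (t : ℕ) (F : Coc k n) : del t (del t F) = 0 := by
  funext T
  simp only [del, Pi.zero_apply, Finset.mul_sum]
  rw [Finset.sum_sigma']
  refine Finset.sum_involution (fun p _ => ⟨p.2, p.1⟩) ?_ ?_ ?_ ?_
  · rintro ⟨j, l⟩ h
    simp only [Finset.mem_sigma, Finset.mem_erase] at h
    have := sg_swap (A := MvPolynomial (Fin n) k) j l T h.1 h.2.2 h.2.1
    simp only
    rw [Finset.erase_right_comm (a := l) (b := j)]
    linear_combination (X j ^ t * X l ^ t * F ((T.erase j).erase l)) * this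
  · rintro ⟨j, l⟩ h _ h2
    simp only [Finset.mem_sigma, Finset.mem_erase] at h
    simp only [Sigma.mk.injEq, heq_eq_eq] at h2
    exact h.2.1 h2.1
  · rintro ⟨j, l⟩ h
    simp only [Finset.mem_sigma, Finset.mem_erase] at h ⊢
    exact ⟨h.2.2, fun e => h.2.1 e.symm, h.1⟩
  · rintro ⟨j, l⟩ h
    rfl

lemma del_hot (t : ℕ) (a : Fin n) (F : Coc k n) :
    del t (hot a F) + hot a (del t F) = (X a ^ t : MvPolynomial (Fin n) k) • F := by
  funext T
  simp only [Pi.add_apply, Pi.smul_apply, smul_eq_mul]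
  by_cases ha : a ∈ T
  · have h1 : hot a (del t F) T = 0 := by simp [hot, ha]
    rw [h1, add_zero, del, Finset.sum_eq_single_of_mem a ha]
    · have h2 := sg_erase a a T ha
      simp only [lt_irrefl, if_false, add_zero] at h2
      simp only [hot, Finset.mem_erase, ne_eq, not_true_eq_false, false_and, if_false,
        Finset.insert_erase ha, h2]
      have : ((-1 : MvPolynomial (Fin n) k) ^ sg a T) * (-1) ^ sg a T = 1 := by
        rw [← mul_pow]; simp
      linear_combination (X a ^ t * F T) * this
    · intro j hj hja
      have : a ∈ T.erase j := Finset.mem_erase.2 ⟨hja.symm, ha⟩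
      simp [hot, this]
  · have haU : a ∈ insert a T := Finset.mem_insert_self _ _
    have h2 := sg_erase a a (insert a T) haU
    simp only [lt_irrefl, if_false, add_zero, Finset.erase_insert ha] at h2
    have sq : ∀ m : ℕ, ((-1 : MvPolynomial (Fin n) k) ^ m) * (-1) ^ m = 1 := by
      intro m; rw [← mul_pow]; simp
    simp only [hot, ha, if_false, del, Finset.mul_sum]
    rw [Finset.sum_insert ha, Finset.erase_insert ha, h2]
    have key : ∀ j ∈ T, (-1 : MvPolynomial (Fin n) k) ^ sg j T *
        (X j ^ t * if a ∈ T.erase j then 0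
          else (-1) ^ sg a (T.erase j) * F (insert a (T.erase j))) =
        - ((-1) ^ sg a (insert a T) *
          ((-1) ^ sg j (insert a T) * (X j ^ t * F ((insert a T).erase j)))) := by
      intro j hj
      have hja : a ≠ j := fun e => ha (e ▸ hj)
      have h3 : a ∉ T.erase j := fun h => ha (Finset.mem_of_mem_erase h)
      have h4 := sg_swap (A := MvPolynomial (Fin n) k) j a (insert a T)
        (Finset.mem_insert_of_mem hj) haU hja
      rw [Finset.erase_insert ha] at h4
      have h5 : (insert a T).erase j = insert a (T.erase j) :=
        Finset.erase_insert_of_ne hja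
      have h6 := sg_erase a a ((insert a T).erase j) (by rw [h5]; simp)
      simp only [lt_irrefl, if_false, add_zero] at h6
      rw [h5, Finset.erase_insert h3, ← h5] at h6
      rw [if_neg h3, ← h5, h6]
      have s1 := sq (sg j T)
      have s2 := sq (sg j (insert a T))
      linear_combination (X j ^ t * F ((insert a T).erase j)) *
        ((-1) ^ sg j T * (-1) ^ sg j (insert a T) * h4
          - ((-1) ^ sg j T * (-1) ^ sg a ((insert a T).erase j)) * s2
          - ((-1) ^ sg a (insert a T) * (-1) ^ sg j (insert a T)) * s1)
    rw [Finset.sum_congr rfl key, Finset.sum_neg_distrib]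
    have s3 := sq (sg a (insert a T))
    linear_combination (X a ^ t * F T) * s3

end Aux

section Grading

lemma sPiece_natCast (e : ℕ) : sPiece k n (e : ℤ) = homogeneousSubmodule (Fin n) k e := by
  simp [sPiece]

lemma sPiece_neg {e : ℤ} (h : e < 0) : sPiece k n e = ⊥ := by
  simp [sPiece, not_le.2 h]

lemma sPiece_mul {a b : ℤ} {f g : MvPolynomial (Fin n) k} (hf : f ∈ sPiece k n a)
    (hg : g ∈ sPiece k n b) : f * g ∈ sPiece k n (a + b) := by
  rcases lt_or_ge a 0 with ha | ha
  · rw [sPiece_neg ha, Submodule.mem_bot] at hf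
    simp [hf]
  rcases lt_or_ge b 0 with hb | hb
  · rw [sPiece_neg hb, Submodule.mem_bot] at hg
    simp [hg]
  lift a to ℕ using ha
  lift b to ℕ using hb
  rw [← Nat.cast_add, sPiece_natCast, mem_homogeneousSubmodule]
  rw [sPiece_natCast, mem_homogeneousSubmodule] at hf hg
  exact hf.mul hg

lemma X_pow_mem_sPiece (j : Fin n) (t : ℕ) :
    (X j ^ t : MvPolynomial (Fin n) k) ∈ sPiece k n t := by
  rw [sPiece_natCast, mem_homogeneousSubmodule]
  simpa using (isHomogeneous_X k j).pow t

lemma prod_mem_sPiece (T : Finset (Fin n)) (s : ℕ) :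
    ((∏ j ∈ T, X j) ^ s : MvPolynomial (Fin n) k) ∈ sPiece k n ((s : ℤ) * T.card) := by
  rw [← Nat.cast_mul, sPiece_natCast, mem_homogeneousSubmodule]
  have := (IsHomogeneous.prod T (fun j => (X j : MvPolynomial (Fin n) k)) (fun _ => 1)
    (fun i _ => isHomogeneous_X k i)).pow s
  simpa [mul_comm] using this

lemma sgn_mul_mem {e : ℤ} (m : ℕ) {f : MvPolynomial (Fin n) k} (hf : f ∈ sPiece k n e) :
    (-1) ^ m * f ∈ sPiece k n e := by
  rcases neg_one_pow_eq_or (MvPolynomial (Fin n) k) m with h | h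
  · simpa [h] using hf
  · simpa [h] using hf

/-- Strand condition. -/
def Str (t : ℕ) (d : ℤ) (F : Coc k n) : Prop := ∀ T, F T ∈ sPiece k n (d + t * T.card)

lemma Str.del {t : ℕ} {d : ℤ} {F : Coc k n} (h : Str t d F) : Str t d (del t F) := by
  intro T
  refine Submodule.sum_mem _ fun j hj => sgn_mul_mem _ ?_
  have := sPiece_mul (X_pow_mem_sPiece (k := k) j t) (h (T.erase j))
  convert this using 2
  have hc := Finset.card_erase_add_one hj
  rw [← hc]
  push_cast
  ring

lemma Str.tau {t : ℕ} {d : ℤ} {F : Coc k n} (h : Str t d F) (s : ℕ) :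
    Str (t + s) d (tau s F) := by
  intro T
  have := sPiece_mul (prod_mem_sPiece (k := k) T s) (h T)
  show (∏ j ∈ T, X j) ^ s * F T ∈ _
  convert this using 2
  push_cast
  ring

lemma Str.smul {t : ℕ} {d e : ℤ} {F : Coc k n} (h : Str t d F) {c : MvPolynomial (Fin n) k}
    (hc : c ∈ sPiece k n e) : Str t (d + e) (c • F) := by
  intro T
  have := sPiece_mul hc (h T)
  show c * F T ∈ _
  convert this using 2
  ring

lemma Str.add {t : ℕ} {d : ℤ} {F G : Coc k n} (h : Str t d F) (h' : Str t d G) :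
    Str t d (F + G) := fun T => Submodule.add_mem _ (h T) (h' T)

lemma Str.sub {t : ℕ} {d : ℤ} {F G : Coc k n} (h : Str t d F) (h' : Str t d G) :
    Str t d (F - G) := fun T => Submodule.sub_mem _ (h T) (h' T)

lemma Str.hot {t : ℕ} {d : ℤ} {F : Coc k n} (h : Str t d F) (a : Fin n) :
    Str t (d + t) (hot a F) := by
  intro T
  unfold Paper.hot
  split_ifs with ha
  · exact Submodule.zero_mem _
  · apply sgn_mul_mem
    have := h (insert a T)
    rw [Finset.card_insert_of_notMem ha] at this
    convert this using 2
    push_cast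
    ring

lemma homComp_mul_lin {l : MvPolynomial (Fin n) k} (hl : l ∈ sPiece k n 1)
    (y : MvPolynomial (Fin n) k) (e : ℕ) :
    homogeneousComponent (e + 1) (l * y) = l * homogeneousComponent e y := by
  have hl' : l ∈ homogeneousSubmodule (Fin n) k 1 := by
    have := sPiece_natCast (k := k) (n := n) 1
    rw [← this]; exact hl
  conv_lhs => rw [← sum_homogeneousComponent y, Finset.mul_sum, map_sum]
  have : ∀ i ∈ Finset.range (y.totalDegree + 1),
      homogeneousComponent (e + 1) (l * homogeneousComponent i y) =
        if i = e then l * homogeneousComponent i y else 0 := by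
    intro i _
    rw [homogeneousComponent_of_mem (n := 1 + i)]
    · by_cases h : i = e
      · rw [if_pos h, if_pos (by omega)]
      · rw [if_neg h, if_neg (by omega)]
    · rw [mem_homogeneousSubmodule] at hl' ⊢
      exact hl'.mul (homogeneousComponent_isHomogeneous i y)
  rw [Finset.sum_congr rfl this, Finset.sum_ite_eq']
  split_ifs with h
  · rfl
  · rw [homogeneousComponent_eq_zero, mul_zero]
    simp at h
    omega

lemma homComp_zero_mul_lin {l : MvPolynomial (Fin n) k} (hl : l ∈ sPiece k n 1)
    (y : MvPolynomial (Fin n) k) :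
    homogeneousComponent 0 (l * y) = 0 := by
  have hl' : l ∈ homogeneousSubmodule (Fin n) k 1 := by
    have := sPiece_natCast (k := k) (n := n) 1
    rw [← this]; exact hl
  have h0 : coeff 0 l = 0 := by
    by_contra h
    have := (mem_homogeneousSubmodule _ _ |>.1 hl') h
    simp at this
  rw [homogeneousComponent_zero]
  have : coeff 0 (l * y) = 0 := by
    have e : ∀ p : MvPolynomial (Fin n) k, coeff 0 p = constantCoeff p := fun p => rfl
    rw [e, map_mul, ← e, h0, zero_mul]
  rw [this, map_zero]

lemma split_lin {J : Ideal (MvPolynomial (Fin n) k)} (hJ : IsHomog J)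
    {l : MvPolynomial (Fin n) k} (hl : l ∈ sPiece k n 1) {e : ℤ} {p : MvPolynomial (Fin n) k}
    (hp : p ∈ sPiece k n e) (hpJ : p ∈ J ⊔ Ideal.span {l}) :
    ∃ y ∈ sPiece k n (e - 1), p - l * y ∈ J := by
  rcases lt_or_ge e 0 with he | he
  · rw [sPiece_neg he, Submodule.mem_bot] at hp
    exact ⟨0, Submodule.zero_mem _, by simp [hp]⟩
  lift e to ℕ using he
  rw [sPiece_natCast] at hp
  obtain ⟨j, hj, q, hq, rfl⟩ := Submodule.mem_sup.1 hpJ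
  obtain ⟨y, rfl⟩ := Ideal.mem_span_singleton'.1 hq
  have hc : homogeneousComponent e (j + y * l) = j + y * l := by
    rw [homogeneousComponent_of_mem hp, if_pos rfl]
  rw [map_add, mul_comm y l] at hc
  rw [mul_comm y l]
  cases e with
  | zero =>
    refine ⟨0, Submodule.zero_mem _, ?_⟩
    rw [homComp_zero_mul_lin hl, add_zero] at hc
    rw [mul_zero, sub_zero, ← hc]
    exact hJ _ hj _
  | succ e =>
    refine ⟨homogeneousComponent e y, ?_, ?_⟩
    · have : ((e + 1 : ℕ) : ℤ) - 1 = (e : ℤ) := by push_cast; ring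
      rw [this, sPiece_natCast]
      exact homogeneousComponent_mem e y
    · rw [homComp_mul_lin hl] at hc
      rw [← hc, add_sub_cancel_right]
      exact hJ _ hj _

lemma isHomog_sup {J : Ideal (MvPolynomial (Fin n) k)} (hJ : IsHomog J)
    {l : MvPolynomial (Fin n) k} (hl : l ∈ sPiece k n 1) : IsHomog (J ⊔ Ideal.span {l}) := by
  intro f hf d
  obtain ⟨j, hj, q, hq, rfl⟩ := Submodule.mem_sup.1 hf
  obtain ⟨y, rfl⟩ := Ideal.mem_span_singleton'.1 hq
  rw [map_add, mul_comm y l]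
  refine Ideal.add_mem _ (Ideal.mem_sup_left (hJ _ hj _)) ?_
  cases d with
  | zero => rw [homComp_zero_mul_lin hl]; exact Ideal.zero_mem _
  | succ e =>
    rw [homComp_mul_lin hl]
    exact Ideal.mem_sup_right (Ideal.mul_mem_right _ _ (Ideal.mem_span_singleton_self l))

end Grading

section Vanish

variable (J : Ideal (MvPolynomial (Fin n) k))

/-- `F` eventually becomes a coboundary modulo `J`. -/
def Cob (t i : ℕ) (d : ℤ) (F : Coc k n) : Prop :=
  ∃ (s : ℕ) (W : Coc k n), (∀ T : Finset (Fin n), T.card + 1 ≠ i → W T = 0) ∧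
    Str (t + s) d W ∧ ∀ T, (del (t + s) W - tau s F) T ∈ J

/-- Vanishing of the degree `d` strand of the `i`-th local cohomology of `S/J`. -/
def Van (i : ℕ) (d : ℤ) : Prop :=
  ∀ (t : ℕ) (F : Coc k n), (∀ T : Finset (Fin n), T.card ≠ i → F T = 0) → Str t d F →
    (∀ T, del t F T ∈ J) → Cob J t i d F

/-- The elements killed by `l` modulo `J` are killed by `𝔐^N`. -/
def TorN (l : MvPolynomial (Fin n) k) (N : ℕ) : Prop :=
  ∀ f, l * f ∈ J → ∀ p ∈ maxIdeal k n ^ N, p * f ∈ J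

variable {J}

lemma tau_tor {l : MvPolynomial (Fin n) k} {N : ℕ} (hN : TorN J l N) (F : Coc k n)
    (h0 : F ∅ = 0) (h : ∀ T, (l • F) T ∈ J) (T) : tau N F T ∈ J := by
  rcases T.eq_empty_or_nonempty with rfl | ⟨j, hj⟩
  · simp [tau, h0]
  · refine hN _ (h T) _ (Ideal.pow_mem_pow ?_ N)
    rw [← Finset.mul_prod_erase T _ hj]
    exact Ideal.mul_mem_right _ _ (Ideal.subset_span ⟨j, rfl⟩)

lemma del_supp {t i : ℕ} {F : Coc k n} (h : ∀ T : Finset (Fin n), T.card ≠ i → F T = 0)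
    (T : Finset (Fin n)) (hT : T.card ≠ i + 1) : del t F T = 0 := by
  refine Finset.sum_eq_zero fun j hj => ?_
  rw [h, mul_zero, mul_zero]
  have := Finset.card_erase_add_one hj
  omega

lemma del_supp' {t i : ℕ} {F : Coc k n} (h : ∀ T : Finset (Fin n), T.card + 1 ≠ i → F T = 0)
    (T : Finset (Fin n)) (hT : T.card ≠ i) : del t F T = 0 := by
  refine Finset.sum_eq_zero fun j hj => ?_
  rw [h, mul_zero, mul_zero]
  have := Finset.card_erase_add_one hj
  omega

lemma cob_step (hJ : IsHomog J) {l : MvPolynomial (Fin n) k} (hl : l ∈ sPiece k n 1) {N : ℕ}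
    (hN : TorN J l N) {t i : ℕ} {d : ℤ} (hV : Van (J ⊔ Ideal.span {l}) i (d + 1))
    {F : Coc k n} (hF : ∀ T : Finset (Fin n), T.card ≠ i + 1 → F T = 0)
    (hc : Cob J t (i + 1) (d + 1) (l • F)) : Cob J t (i + 1) d F := by
  obtain ⟨s, W, hW0, hWs, hW⟩ := hc
  have hW0' : ∀ T : Finset (Fin n), T.card ≠ i → W T = 0 := fun T hT => hW0 T (by omega)
  obtain ⟨s1, U, hU0, hUs, hU⟩ := hV (t + s) W hW0' hWs (by
    intro T
    have h1 := hW T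
    rw [tau_smul] at h1
    have : del (t + s) W T = (del (t + s) W - l • tau s F) T + l * tau s F T := by
      simp
    rw [this]
    exact Ideal.add_mem _ (Ideal.mem_sup_left h1)
      (Ideal.mem_sup_right (Ideal.mul_mem_right _ _ (Ideal.mem_span_singleton_self l))))
  have hp : Str (t + s + s1) (d + 1) (tau s1 W - del (t + s + s1) U) := (hWs.tau s1).sub hUs.del
  have hex : ∀ T : Finset (Fin n), ∃ y, y ∈ sPiece k n (d + (t + s + s1 : ℕ) * T.card) ∧
      (T.card ≠ i → y = 0) ∧ (tau s1 W - del (t + s + s1) U) T - l * y ∈ J := by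
    intro T
    by_cases hT : T.card = i
    · obtain ⟨y, hy, hy'⟩ := split_lin hJ hl (hp T) (by
        have := Ideal.neg_mem_iff _ |>.2 (hU T)
        simpa using this)
      refine ⟨y, ?_, fun h => absurd hT h, hy'⟩
      convert hy using 2
      ring
    · refine ⟨0, Submodule.zero_mem _, fun _ => rfl, ?_⟩
      have h1 : tau s1 W T = 0 := by simp [tau, hW0' T hT]
      have h2 : del (t + s + s1) U T = 0 := del_supp' hU0 T hT
      simp [h1, h2]
  choose Y hYs hY0 hY using hex
  have hYs' : Str (t + s + s1) d Y := hYs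
  have hG : ∀ T, (l • (tau (s + s1) F - del (t + s + s1) Y)) T ∈ J := by
    intro T
    have e : l • (tau (s + s1) F - del (t + s + s1) Y) =
        del (t + s + s1) (tau s1 W - del (t + s + s1) U - l • Y)
          - tau s1 (del (t + s) W - tau s (l • F)) := by
      simp only [del_sub, del_del, del_tau, tau_sub, tau_smul, del_smul, tau_tau, smul_sub]
      abel
    rw [e]
    exact Ideal.sub_mem _ (del_mem J _ _ hY T) (tau_mem J _ _ hW T)
  have hfin := tau_tor hN _ (by
    have h1 : tau (s + s1) F ∅ = 0 := by
      simp only [tau]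
      rw [hF ∅ (by simp), mul_zero]
    have h2 : del (t + s + s1) Y ∅ = 0 := by simp [del]
    simp [h1, h2]) hG
  refine ⟨s + s1 + N, tau N Y, ?_, ?_, ?_⟩
  · intro T hT
    simp only [tau]
    rw [hY0 T (by omega), mul_zero]
  · have := hYs'.tau N
    simpa only [add_assoc] using this
  · intro T
    have h := Ideal.neg_mem_iff _ |>.2 (hfin T)
    have e : -(tau N (tau (s + s1) F - del (t + s + s1) Y)) =
        del (t + (s + s1 + N)) (tau N Y) - tau (s + s1 + N) F := by
      rw [show t + (s + s1 + N) = t + s + s1 + N by ring, del_tau, tau_sub, tau_tau]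
      abel
    rw [← e]
    exact h

lemma cob_of_large {t i e : ℕ} {d : ℤ} {F : Coc k n}
    (hF : ∀ T : Finset (Fin n), T.card ≠ i + 1 → F T = 0) (hFs : Str t d F)
    (hFc : ∀ T, del t F T ∈ J) {p : MvPolynomial (Fin n) k}
    (hp : p ∈ homogeneousSubmodule (Fin n) k e) (he : n * t < e) :
    Cob J t (i + 1) (d + e) (p • F) := by
  suffices h : ∃ W : Coc k n, (∀ T : Finset (Fin n), T.card + 1 ≠ i + 1 → W T = 0) ∧
      Str t (d + e) W ∧ ∀ T, (del t W - p • F) T ∈ J by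
    obtain ⟨W, h1, h2, h3⟩ := h
    refine ⟨0, W, h1, h2, ?_⟩
    rw [tau_zero]
    exact h3
  have hsum : p = ∑ v ∈ p.support, monomial v (coeff v p) := p.as_sum
  rw [hsum]
  refine Finset.sum_induction _ (fun q => ∃ W : Coc k n,
    (∀ T : Finset (Fin n), T.card + 1 ≠ i + 1 → W T = 0) ∧
      Str t (d + e) W ∧ ∀ T, (del t W - q • F) T ∈ J) ?_ ?_ ?_
  · rintro a b ⟨W, h1, h2, h3⟩ ⟨W', h1', h2', h3'⟩
    refine ⟨W + W', fun T hT => by simp [h1 T hT, h1' T hT], h2.add h2', fun T => ?_⟩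
    have : del t (W + W') - (a + b) • F = (del t W - a • F) + (del t W' - b • F) := by
      rw [del_add, add_smul]; abel
    rw [this]
    exact J.add_mem (h3 T) (h3' T)
  · refine ⟨0, fun _ _ => rfl, fun T => Submodule.zero_mem _, fun T => ?_⟩
    simp [del_zero]
  · intro v hv
    have hdeg : ∑ j, v j = e := by
      have := (mem_homogeneousSubmodule _ _ |>.1 hp) (mem_support_iff.1 hv)
      rw [← this, Finsupp.weight_apply]
      simp [Finsupp.sum_fintype]
    have hj : ∃ j, t ≤ v j := by
      by_contra! h
      have : ∑ j, v j ≤ ∑ j : Fin n, t := Finset.sum_le_sum fun j _ => (h j).le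
      simp at this
      omega
    obtain ⟨j, hj⟩ := hj
    set b : Fin n →₀ ℕ := v - Finsupp.single j t with hb
    have hvb : v = b + Finsupp.single j t := by
      rw [hb, tsub_add_cancel_of_le]
      exact Finsupp.single_le_iff.2 hj
    have hmon : (monomial v (coeff v p) : MvPolynomial (Fin n) k) =
        monomial b (coeff v p) * X j ^ t := by
      conv_lhs => rw [hvb]
      rw [monomial_add_single]
      rw [← hvb]
    have hbdeg : (monomial b (coeff v p) : MvPolynomial (Fin n) k) ∈
        sPiece k n ((e : ℤ) - t) := by
      have h1 : ∑ x, b x + t = e := by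
        rw [← hdeg, hvb]
        simp [Finset.sum_add_distrib]
      have h2 : (e : ℤ) - t = ((∑ x, b x : ℕ) : ℤ) := by
        rw [← h1]; push_cast; ring
      rw [h2, sPiece_natCast, mem_homogeneousSubmodule]
      refine isHomogeneous_monomial _ ?_
      rw [Finsupp.degree_eq_sum]
    refine ⟨monomial b (coeff v p) • hot j F, ?_, ?_, ?_⟩
    · intro T hT
      simp only [Pi.smul_apply, hot]
      split_ifs with ha
      · simp
      · rw [hF, mul_zero, smul_zero]
        rw [Finset.card_insert_of_notMem ha]
        exact hT
    · have := (hFs.hot j).smul hbdeg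
      convert this using 1
      ring
    · intro T
      have h1 := del_hot t j F
      have : del t ((monomial b (coeff v p) : MvPolynomial (Fin n) k) • hot j F) -
          (monomial v (coeff v p) : MvPolynomial (Fin n) k) • F =
          -((monomial b (coeff v p) : MvPolynomial (Fin n) k) • hot j (del t F)) := by
        rw [hmon, mul_smul, ← h1, del_smul, smul_add]
        abel
      rw [this]
      refine (Ideal.neg_mem_iff _).2 (J.mul_mem_left _ ?_)
      unfold hot
      split_ifs
      · exact J.zero_mem
      · exact J.mul_mem_left _ (hFc _)

lemma pow_lin_mem {l : MvPolynomial (Fin n) k} (hl : l ∈ sPiece k n 1) (m : ℕ) :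
    l ^ m ∈ homogeneousSubmodule (Fin n) k m := by
  have hl' : l ∈ homogeneousSubmodule (Fin n) k 1 := by
    have := sPiece_natCast (k := k) (n := n) 1
    rw [← this]; exact hl
  rw [mem_homogeneousSubmodule] at hl' ⊢
  simpa using hl'.pow m

/-- Step (A). -/
lemma van_up (hJ : IsHomog J) {l : MvPolynomial (Fin n) k} (hl : l ∈ sPiece k n 1) {N : ℕ}
    (hN : TorN J l N) {i : ℕ} {d : ℤ}
    (hV : ∀ d' ≥ d + 1, Van (J ⊔ Ideal.span {l}) i d') : Van J (i + 1) d := by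
  intro t F hF hFs hFc
  have key : ∀ m : ℕ, Cob J t (i + 1) (d + m) (l ^ m • F) → Cob J t (i + 1) d F := by
    intro m
    induction m with
    | zero => intro h; simpa using h
    | succ m ih =>
      intro h
      apply ih
      refine cob_step hJ hl hN (hV _ (by omega)) ?_ ?_
      · intro T hT
        simp [hF T hT]
      · rw [smul_smul, ← pow_succ']
        convert h using 1
        push_cast
        ring
  exact key (n * t + 1) (cob_of_large hF hFs hFc (pow_lin_mem hl _) (by omega))

/-- Step (B). -/
lemma van_down (hJ : IsHomog J) {l : MvPolynomial (Fin n) k} (hl : l ∈ sPiece k n 1) {N : ℕ}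
    (hN : TorN J l N) {i : ℕ} {d : ℤ}
    (hV : Van J i d) (hV' : Van J (i + 1) (d - 1)) : Van (J ⊔ Ideal.span {l}) i d := by
  intro t F hF hFs hFc
  have hex : ∀ T : Finset (Fin n), ∃ y, y ∈ sPiece k n (d - 1 + t * T.card) ∧
      (T.card ≠ i + 1 → y = 0) ∧ del t F T - l * y ∈ J := by
    intro T
    by_cases hT : T.card = i + 1
    · obtain ⟨y, hy, hy'⟩ := split_lin hJ hl (hFs.del T) (hFc T)
      refine ⟨y, ?_, fun h => absurd hT h, hy'⟩
      convert hy using 2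
      ring
    · refine ⟨0, Submodule.zero_mem _, fun _ => rfl, ?_⟩
      simp [del_supp hF T hT]
  choose G hGs hG0 hG using hex
  have hGs' : Str t (d - 1) G := hGs
  have hG' : ∀ T, (del t F - l • G) T ∈ J := hG
  have h1 : ∀ T, (l • del t G) T ∈ J := by
    intro T
    have e : l • del t G = -del t (del t F - l • G) := by
      rw [del_sub, del_del, del_smul]; abel
    rw [e]
    exact (Ideal.neg_mem_iff _).2 (del_mem J _ _ hG' T)
  have h2 := tau_tor hN _ (by simp [del]) h1
  rw [← del_tau] at h2
  obtain ⟨s, Y, hY0, hYs, hY⟩ := hV' (t + N) (tau N G) (by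
    intro T hT
    simp only [tau]
    rw [hG0 T hT, mul_zero]) (hGs'.tau N) h2
  have hlY : Str (t + N + s) d (l • Y) := by
    have := hYs.smul hl
    simpa using this
  obtain ⟨s1, W, hW0, hWs, hW⟩ := hV (t + N + s) (tau s (tau N F) - l • Y) (by
    intro T hT
    have : Y T = 0 := hY0 T (by omega)
    simp [tau, hF T hT, this]) (((hFs.tau N).tau s).sub hlY) (by
    intro T
    have e : del (t + N + s) (tau s (tau N F) - l • Y) =
        tau s (tau N (del t F - l • G)) - l • (del (t + N + s) Y - tau s (tau N G)) := by
      simp only [del_sub, del_tau, tau_sub, tau_smul, del_smul, smul_sub]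
      abel
    rw [e]
    exact J.sub_mem (tau_mem J _ _ (tau_mem J _ _ hG') T) (J.mul_mem_left _ (hY T)))
  refine ⟨N + s + s1, W, hW0, ?_, ?_⟩
  · simpa only [add_assoc] using hWs
  · intro T
    have e : del (t + (N + s + s1)) W - tau (N + s + s1) F =
        (del (t + N + s + s1) W - tau s1 (tau s (tau N F) - l • Y)) - l • tau s1 Y := by
      rw [show t + (N + s + s1) = t + N + s + s1 by ring]
      simp only [tau_sub, tau_smul, tau_tau]
      abel
    rw [e]
    exact Ideal.sub_mem _ (Ideal.mem_sup_left (hW T))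
      (Ideal.mem_sup_right (Ideal.mul_mem_right _ _ (Ideal.mem_span_singleton_self l)))

/-- Degrees where `(J : l)` and `J` differ. -/
def CSet (J : Ideal (MvPolynomial (Fin n) k)) (l : MvPolynomial (Fin n) k) : Set ℤ :=
  {d | ∃ f ∈ sPiece k n d, l * f ∈ J ∧ f ∉ J}

lemma cset_to_lc {l : MvPolynomial (Fin n) k} {N : ℕ}
    (hN : TorN J l N) {d : ℤ} (hd : d ∈ CSet J l) : ¬ Van J 0 d := by
  obtain ⟨f, hf, hlf, hfJ⟩ := hd
  intro hV
  obtain ⟨s, W, hW0, hWs, hW⟩ := hV N (fun T => if T = ∅ then f else 0) (by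
    intro T hT
    rw [if_neg]
    rintro rfl
    simp at hT) (by
    intro T
    simp only
    split_ifs with h
    · subst h; simpa using hf
    · exact Submodule.zero_mem _) (by
    intro T
    refine J.sum_mem fun j hj => J.mul_mem_left _ ?_
    beta_reduce
    split_ifs
    · exact hN f hlf _ (Ideal.pow_mem_pow (Ideal.subset_span (Set.mem_range_self j)) N)
    · simp)
  have := hW ∅
  simp [del, tau] at this
  exact hfJ this

lemma lc_to_cset {l : MvPolynomial (Fin n) k} (hl : l ∈ sPiece k n 1) {d : ℤ}
    (hV : ¬ Van J 0 d) : ∃ d' ≥ d, d' ∈ CSet J l := by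
  unfold Van at hV
  push Not at hV
  obtain ⟨t, F, hF, hFs, hFc, hC⟩ := hV
  have hf : F ∅ ∉ J := by
    intro h
    apply hC
    refine ⟨0, 0, fun _ _ => rfl, fun _ => Submodule.zero_mem _, fun T => ?_⟩
    rw [del_zero, tau_zero]
    by_cases hT : T.card = 0
    · rw [Finset.card_eq_zero.1 hT]
      simpa using h
    · simp [hF T hT]
  have hx : ∀ j, X j ^ t * F ∅ ∈ J := by
    intro j
    have := hFc {j}
    simpa [del, sg, Finset.filter_singleton] using this
  have hpow : ∃ m, l ^ m * F ∅ ∈ J := by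
    refine ⟨n * t + 1, ?_⟩
    have hp := pow_lin_mem hl (n * t + 1)
    rw [(l ^ (n * t + 1)).as_sum, Finset.sum_mul]
    refine J.sum_mem fun v hv => ?_
    have hdeg : ∑ j, v j = n * t + 1 := by
      have := (mem_homogeneousSubmodule _ _ |>.1 hp) (mem_support_iff.1 hv)
      rw [← this, Finsupp.weight_apply]
      simp [Finsupp.sum_fintype]
    have hj : ∃ j, t ≤ v j := by
      by_contra! h
      have : ∑ j, v j ≤ ∑ j : Fin n, t := Finset.sum_le_sum fun j _ => (h j).le
      simp at this
      omega
    obtain ⟨j, hj⟩ := hj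
    have hvb : v = (v - Finsupp.single j t) + Finsupp.single j t := by
      rw [tsub_add_cancel_of_le]
      exact Finsupp.single_le_iff.2 hj
    generalize coeff v (l ^ (n * t + 1)) = c
    rw [hvb, monomial_add_single, mul_assoc]
    exact J.mul_mem_left _ (hx j)
  classical
  obtain ⟨m, hm, hmin⟩ : ∃ m, l ^ m * F ∅ ∈ J ∧ ∀ m' < m, l ^ m' * F ∅ ∉ J :=
    ⟨Nat.find hpow, Nat.find_spec hpow, fun m' h => Nat.find_min hpow h⟩
  cases m with
  | zero => exact absurd (by simpa using hm) hf
  | succ m =>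
    refine ⟨d + m, by omega, l ^ m * F ∅, ?_, ?_, hmin m (by omega)⟩
    · have h1 := pow_lin_mem hl m
      rw [← sPiece_natCast] at h1
      have := sPiece_mul h1 (hFs ∅)
      convert this using 2
      simp
      ring
    · rw [← mul_assoc, ← pow_succ']
      exact hm

lemma sPiece_le_pow (d : ℕ) {f : MvPolynomial (Fin n) k} (hf : f ∈ homogeneousSubmodule (Fin n) k d) :
    f ∈ maxIdeal k n ^ d := by
  rw [f.as_sum]
  refine Ideal.sum_mem _ fun v hv => ?_
  have hdeg : ∑ j, v j = d := by
    have := (mem_homogeneousSubmodule _ _ |>.1 hf) (mem_support_iff.1 hv)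
    rw [← this, Finsupp.weight_apply]
    simp [Finsupp.sum_fintype]
  rw [monomial_eq, Finsupp.prod_fintype _ _ (by simp)]
  refine Ideal.mul_mem_left _ _ ?_
  rw [← hdeg, ← Finset.prod_pow_eq_pow_sum]
  exact Ideal.prod_mem_prod fun j _ => Ideal.pow_mem_pow
    (Ideal.subset_span (Set.mem_range_self j)) _

lemma cset_bdd {l : MvPolynomial (Fin n) k} {N : ℕ}
    (hN : TorN J l N) : BddAbove (CSet J l) := by
  obtain ⟨c, hc⟩ := Ideal.exists_pow_inf_eq_pow_smul (maxIdeal k n)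
    (J.colon ({l} : Set (MvPolynomial (Fin n) k)) :
      Submodule (MvPolynomial (Fin n) k) (MvPolynomial (Fin n) k))
  refine ⟨(c + N : ℕ), fun d hd => ?_⟩
  obtain ⟨f, hf, hlf, hfJ⟩ := hd
  by_contra! hlt
  apply hfJ
  have hd0 : 0 ≤ d := le_trans (Int.natCast_nonneg _) hlt.le
  lift d to ℕ using hd0
  rw [sPiece_natCast] at hf
  have hcd : c + N < d := by exact_mod_cast hlt
  have hmem : f ∈ maxIdeal k n ^ (d - c) •
      (maxIdeal k n ^ c • ⊤ ⊓ (J.colon ({l} : Set (MvPolynomial (Fin n) k)) :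
      Submodule (MvPolynomial (Fin n) k) (MvPolynomial (Fin n) k))) := by
    rw [← hc d (by omega)]
    refine ⟨?_, ?_⟩
    · have := sPiece_le_pow d hf
      simpa using this
    · rw [SetLike.mem_coe, Submodule.mem_colon_singleton, smul_eq_mul, mul_comm]
      exact hlf
  refine Submodule.smul_induction_on hmem ?_ (fun _ _ => J.add_mem)
  intro p hp g hg
  refine hN g ?_ p (Ideal.pow_le_pow_right (by omega) hp)
  have := Submodule.mem_colon_singleton.1 hg.2
  rwa [smul_eq_mul, mul_comm] at this

end Vanish

section Bridge

lemma mem_qPiece {J : Ideal (MvPolynomial (Fin n) k)} {e : ℤ} {x : MvPolynomial (Fin n) k ⧸ J} :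
    x ∈ qPiece J e ↔ ∃ f ∈ sPiece k n e, Ideal.Quotient.mk J f = x := Iff.rfl

lemma mk_mem_qPiece {J : Ideal (MvPolynomial (Fin n) k)} {e : ℤ} {f : MvPolynomial (Fin n) k}
    (hf : f ∈ sPiece k n e) : Ideal.Quotient.mk J f ∈ qPiece J e := ⟨f, hf, rfl⟩

lemma kdelta_mk (J : Ideal (MvPolynomial (Fin n) k)) (t i : ℕ) (F : Coc k n)
    (T : {T : Finset (Fin n) // T.card = i})
    (v : Koch n (MvPolynomial (Fin n) k ⧸ J) (i - 1))
    (hv : ∀ (j) (hj : j ∈ T.1), v ⟨T.1.erase j, by rw [Finset.card_erase_of_mem hj, T.2]⟩ =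
      Ideal.Quotient.mk J (F (T.1.erase j))) :
    kdelta (k := k) t i v T = Ideal.Quotient.mk J (del t F T.1) := by
  unfold kdelta del
  rw [map_sum, ← Finset.sum_attach T.1]
  refine Finset.sum_congr rfl fun j _ => ?_
  rw [hv j.1 j.2, map_mul, map_pow, map_neg, map_one, zsmul_eq_mul]
  push_cast
  rfl

lemma ktrans_iter (J : Ideal (MvPolynomial (Fin n) k)) (s i : ℕ) (F : Coc k n)
    (v : Koch n (MvPolynomial (Fin n) k ⧸ J) i)
    (hv : ∀ T, v T = Ideal.Quotient.mk J (F T.1)) (T) :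
    (ktrans (k := k) i)^[s] v T = Ideal.Quotient.mk J (tau s F T.1) := by
  induction s generalizing T with
  | zero => simp [tau, hv]
  | succ s ih =>
    rw [Function.iterate_succ_apply']
    unfold ktrans at ih ⊢
    rw [ih]
    show Ideal.Quotient.mk J ((∏ j ∈ T.1, X j) * tau s F T.1) = _
    congr 1
    simp only [tau]
    ring

lemma lc_iff (J : Ideal (MvPolynomial (Fin n) k)) (i : ℕ) (d : ℤ) :
    lcNonvanish (k := k) n (qPiece J) i d ↔ ¬ Van J i d := by
  classical
  constructor
  · rintro ⟨t, v, hvs, hvc, hv⟩ hV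
    have hlift : ∀ T : Finset (Fin n), ∃ f, f ∈ sPiece k n (d + t * T.card) ∧
        (T.card ≠ i → f = 0) ∧ ∀ h : T.card = i, Ideal.Quotient.mk J f = v ⟨T, h⟩ := by
      intro T
      by_cases hT : T.card = i
      · obtain ⟨f, hf, hfv⟩ := mem_qPiece.1 (hvs ⟨T, hT⟩)
        exact ⟨f, by rw [hT]; exact hf, fun h => absurd hT h, fun _ => hfv⟩
      · exact ⟨0, Submodule.zero_mem _, fun _ => rfl, fun h => absurd h hT⟩
    choose F hFs hF0 hFv using hlift
    obtain ⟨s, W, hW0, hWs, hW⟩ := hV t F hF0 hFs (by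
      intro T
      by_cases hT : T.card = i + 1
      · have := congrFun hvc ⟨T, hT⟩
        rw [kdelta_mk J t (i + 1) F ⟨T, hT⟩ v] at this
        · exact Ideal.Quotient.eq_zero_iff_mem.1 this
        · intro j hj
          exact (hFv _ _).symm
      · rw [del_supp hF0 T hT]
        exact J.zero_mem)
    refine hv s ⟨fun T => Ideal.Quotient.mk J (W T.1), ?_, ?_⟩
    · intro T
      have := mk_mem_qPiece (J := J) (hWs T.1)
      rw [T.2] at this
      exact this
    · funext T
      rw [kdelta_mk J (t + s) i W T _ (fun _ _ => rfl),
        ktrans_iter J s i F v (fun T => (hFv _ _).symm)]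
      exact Ideal.Quotient.eq.2 (hW T.1)
  · intro hV
    unfold Van at hV
    push Not at hV
    obtain ⟨t, F, hF0, hFs, hFc, hC⟩ := hV
    refine ⟨t, fun T => Ideal.Quotient.mk J (F T.1), ?_, ?_, ?_⟩
    · intro T
      have := mk_mem_qPiece (J := J) (hFs T.1)
      rw [T.2] at this
      exact this
    · funext T
      rw [kdelta_mk J t (i + 1) F T _ (fun _ _ => rfl)]
      exact Ideal.Quotient.eq_zero_iff_mem.2 (hFc T.1)
    · rintro s ⟨w, hws, hw⟩
      apply hC
      have hlift : ∀ T : Finset (Fin n), ∃ f, f ∈ sPiece k n (d + (t + s : ℕ) * T.card) ∧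
          (T.card + 1 ≠ i → f = 0) ∧
          (T.card + 1 = i → ∀ h : T.card = i - 1, Ideal.Quotient.mk J f = w ⟨T, h⟩) := by
        intro T
        by_cases hT : T.card + 1 = i
        · have hT' : T.card = i - 1 := by omega
          obtain ⟨f, hf, hfv⟩ := mem_qPiece.1 (hws ⟨T, hT'⟩)
          exact ⟨f, by rw [hT']; exact hf, fun h => absurd hT h, fun _ _ => hfv⟩
        · exact ⟨0, Submodule.zero_mem _, fun _ => rfl, fun h => absurd h hT⟩
      choose W hWs hW0 hWv using hlift
      refine ⟨s, W, hW0, hWs, ?_⟩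
      intro T
      by_cases hT : T.card = i
      · have := congrFun hw ⟨T, hT⟩
        rw [kdelta_mk J (t + s) i W ⟨T, hT⟩ w, ktrans_iter J s i F _ (fun _ => rfl)] at this
        · exact Ideal.Quotient.eq.1 this
        · intro j hj
          refine (hWv _ ?_ _).symm
          rw [Finset.card_erase_add_one hj]
          exact hT
      · rw [Pi.sub_apply, del_supp' hW0 T hT]
        simp [tau, hF0 T hT]

end Bridge

section FR

lemma filter_torsion {R : Type*} [CommRing R] [IsNoetherianRing R] (mR : Ideal R) (a : Ideal R)
    (z : R) (h : ∀ p ∈ associatedPrimes R (R ⧸ a), p ≠ mR → z ∉ p) :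
    ∃ N : ℕ, ∀ f, z * f ∈ a → ∀ p ∈ mR ^ N, p * f ∈ a := by
  let K : Submodule R (R ⧸ a) := LinearMap.ker (LinearMap.lsmul R (R ⧸ a) z)
  have hass : ∀ p ∈ associatedPrimes R K, p = mR := by
    intro p hp
    have hp' : p ∈ associatedPrimes R (R ⧸ a) :=
      associatedPrimes.subset_of_injective (f := K.subtype) K.injective_subtype hp
    by_contra hne
    refine h p hp' hne ?_
    refine IsAssociatedPrime.annihilator_le hp ?_
    rw [Module.mem_annihilator]
    rintro ⟨⟨x, hx⟩, _⟩
    exact Subtype.ext (Subtype.ext hx)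
  have hrad : mR ≤ (Module.annihilator R K).radical := by
    rw [← Ideal.sInf_minimalPrimes]
    refine le_sInf fun p hp => ?_
    rw [hass p (Module.associatedPrimes.minimalPrimes_annihilator_subset_associatedPrimes R K hp)]
  obtain ⟨N, hN⟩ := Ideal.exists_pow_le_of_le_radical_of_fg hrad (IsNoetherian.noetherian mR)
  refine ⟨N, fun f hf p hp => ?_⟩
  have hfK : Ideal.Quotient.mk a f ∈ K := by
    show z • Ideal.Quotient.mk a f = 0
    exact Ideal.Quotient.eq_zero_iff_mem.2 hf
  have := Module.mem_annihilator.1 (hN hp) ⟨_, hfK⟩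
  have := congrArg Subtype.val this
  exact Ideal.Quotient.eq_zero_iff_mem.1 this

/-- The preimage in `S` of `(z_0, …, z_{i-1})`. -/
def Jc (I : Ideal (MvPolynomial (Fin n) k)) (l : ℕ → MvPolynomial (Fin n) k) :
    ℕ → Ideal (MvPolynomial (Fin n) k)
  | 0 => I
  | i + 1 => Jc I l i ⊔ Ideal.span {l i}

lemma mem_Jc (I : Ideal (MvPolynomial (Fin n) k)) (l : ℕ → MvPolynomial (Fin n) k)
    (z : ℕ → MvPolynomial (Fin n) k ⧸ I) (i : ℕ) (hz : ∀ j < i, Ideal.Quotient.mk I (l j) = z j)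
    (f : MvPolynomial (Fin n) k) :
    Ideal.Quotient.mk I f ∈ Ideal.span {x | ∃ j < i, x = z j} ↔ f ∈ Jc I l i := by
  have h1 : Jc I l i = Ideal.span {x | ∃ j < i, x = l j} ⊔ I := by
    clear hz
    induction i with
    | zero => simp [Jc]
    | succ i ih =>
      rw [Jc, ih]
      have : {x | ∃ j < i + 1, x = l j} = {x | ∃ j < i, x = l j} ∪ {l i} := by
        ext x
        simp only [Set.mem_ofPred_eq, Set.mem_union, Set.mem_singleton_iff]
        constructor
        · rintro ⟨j, hj, rfl⟩
          rcases Nat.lt_succ_iff_lt_or_eq.1 hj with h | rfl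
          · exact Or.inl ⟨j, h, rfl⟩
          · exact Or.inr rfl
        · rintro (⟨j, hj, rfl⟩ | rfl)
          · exact ⟨j, by omega, rfl⟩
          · exact ⟨i, by omega, rfl⟩
      rw [this, Ideal.span_union]
      ac_rfl
  have h2 : Ideal.span {x | ∃ j < i, x = z j} =
      (Ideal.span {x | ∃ j < i, x = l j}).map (Ideal.Quotient.mk I) := by
    rw [Ideal.map_span]
    congr 1
    ext x
    constructor
    · rintro ⟨j, hj, rfl⟩
      exact ⟨l j, ⟨j, hj, rfl⟩, hz j hj⟩
    · rintro ⟨_, ⟨j, hj, rfl⟩, rfl⟩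
      exact ⟨j, hj, hz j hj⟩
  rw [h1, h2, ← Ideal.mem_comap,
    Ideal.comap_map_of_surjective _ Ideal.Quotient.mk_surjective, ← RingHom.ker_eq_comap_bot,
    Ideal.mk_ker]

end FR

section Final

lemma isGreatest_of_dom {A C : Set ℤ} (h1 : ∀ a ∈ A, ∃ c ∈ C, a ≤ c) (h2 : ∀ c ∈ C, ∃ a ∈ A, c ≤ a)
    {r : ℤ} (h : IsGreatest A r) : IsGreatest C r := by
  have hub : r ∈ upperBounds C := by
    intro c hc
    obtain ⟨a, ha, hca⟩ := h2 c hc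
    exact hca.trans (h.2 ha)
  obtain ⟨c, hc, hrc⟩ := h1 r h.1
  have := hub hc
  have : c = r := le_antisymm this hrc
  exact ⟨this ▸ hc, hub⟩

/-- supremum of shifted `aDeg`. -/
lemma sup_iff {M : Type*} [AddCommGroup M] [Module k M] [Module (MvPolynomial (Fin n) k) M]
    (ℳ : ℤ → Submodule k M) (t : ℕ) (c : ℕ → ℤ)
    (hb : ∀ i ≤ t, BddAbove {d : ℤ | lcNonvanish n ℳ i d}) (r : ℤ) :
    ((Finset.range (t + 1)).sup fun i => aDeg n ℳ i + ((c i : ℤ) : WithBot ℤ)) = (r : WithBot ℤ) ↔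
      IsGreatest {r' : ℤ | ∃ i ≤ t, lcNonvanish n ℳ i (r' - c i)} r := by
  have hle : ∀ i ≤ t, ∀ d : ℤ, lcNonvanish n ℳ i d → (d : WithBot ℤ) ≤ aDeg n ℳ i := by
    intro i hi d hd
    unfold aDeg
    rw [if_pos ⟨d, hd⟩]
    exact WithBot.coe_le_coe.2 (le_csSup (hb i hi) hd)
  have hat : ∀ i ≤ t, aDeg n ℳ i ≠ ⊥ → ∃ d : ℤ, aDeg n ℳ i = d ∧ lcNonvanish n ℳ i d := by
    intro i hi hne
    unfold aDeg at hne ⊢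
    split_ifs at hne ⊢ with h
    · exact ⟨_, rfl, Int.csSup_mem h (hb i hi)⟩
    · exact absurd rfl hne
  constructor
  · intro h
    refine ⟨?_, ?_⟩
    · obtain ⟨i, hi, hir⟩ := Finset.exists_mem_eq_sup (Finset.range (t + 1)) ⟨0, by simp⟩
        (fun i => aDeg n ℳ i + ((c i : ℤ) : WithBot ℤ))
      rw [h] at hir
      have hi' : i ≤ t := by simpa [Nat.lt_succ_iff] using hi
      obtain ⟨d, hd, hd'⟩ := hat i hi' (by
        intro hbot
        simp [hbot] at hir)
      rw [hd, ← WithBot.coe_add, WithBot.coe_inj] at hir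
      refine ⟨i, hi', ?_⟩
      rw [hir, add_sub_cancel_right]
      exact hd'
    · rintro r' ⟨i, hi, hd⟩
      have h1 := hle i hi _ hd
      have h2 := Finset.le_sup (f := fun i => aDeg n ℳ i + ((c i : ℤ) : WithBot ℤ))
        (Finset.mem_range.2 (Nat.lt_succ_of_le hi))
      rw [h] at h2
      have h3 := (add_le_add_left h1 ((c i : ℤ) : WithBot ℤ)).trans h2
      rw [← WithBot.coe_add, WithBot.coe_le_coe] at h3
      simpa using h3
  · rintro ⟨⟨i, hi, hd⟩, hub⟩
    apply le_antisymm
    · refine Finset.sup_le fun j hj => ?_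
      have hj' : j ≤ t := by simpa [Nat.lt_succ_iff] using hj
      by_cases hbot : aDeg n ℳ j = ⊥
      · simp [hbot]
      · obtain ⟨d, hd1, hd2⟩ := hat j hj' hbot
        rw [hd1, ← WithBot.coe_add, WithBot.coe_le_coe]
        exact hub ⟨j, hj', by rw [add_sub_cancel_right]; exact hd2⟩
    · have h1 := hle i hi _ hd
      have h2 := Finset.le_sup (f := fun i => aDeg n ℳ i + ((c i : ℤ) : WithBot ℤ))
        (Finset.mem_range.2 (Nat.lt_succ_of_le hi))
      have h3 := (add_le_add_left h1 ((c i : ℤ) : WithBot ℤ)).trans h2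
      rw [← WithBot.coe_add] at h3
      simpa using h3

end Final

theorem statement0 {k : Type*} [Field k] {n : ℕ}
    (I : Ideal (MvPolynomial (Fin n) k)) (hI : IsHomog I) (t : ℕ)
    (z : ℕ → MvPolynomial (Fin n) k ⧸ I)
    (hlin : ∀ j ≤ t, z j ∈ qPiece I 1)
    (hfr : FilterRegular (maxIdealQ I) z (t + 1)) :
    (∀ r : ℤ,
      regT n (qPiece I) t = (r : WithBot ℤ) ↔
        IsGreatest {r' : ℤ | ∃ i ≤ t,
          (((Ideal.span {x | ∃ j < i, x = z j}).colon (Ideal.span {z i}) :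
              Ideal (MvPolynomial (Fin n) k ⧸ I)) : Set (MvPolynomial (Fin n) k ⧸ I))
              ∩ (qPiece I r' : Set (MvPolynomial (Fin n) k ⧸ I)) ≠
          ((Ideal.span {x | ∃ j < i, x = z j} :
              Ideal (MvPolynomial (Fin n) k ⧸ I)) : Set (MvPolynomial (Fin n) k ⧸ I))
              ∩ (qPiece I r' : Set (MvPolynomial (Fin n) k ⧸ I))} r) ∧
    (∀ a : ℤ,
      aStarT n (qPiece I) t = (a : WithBot ℤ) ↔
        IsGreatest {a' : ℤ | ∃ i ≤ t,
          (((Ideal.span {x | ∃ j < i, x = z j}).colon (Ideal.span {z i}) :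
              Ideal (MvPolynomial (Fin n) k ⧸ I)) : Set (MvPolynomial (Fin n) k ⧸ I))
              ∩ (qPiece I (a' + i) : Set (MvPolynomial (Fin n) k ⧸ I)) ≠
          ((Ideal.span {x | ∃ j < i, x = z j} :
              Ideal (MvPolynomial (Fin n) k ⧸ I)) : Set (MvPolynomial (Fin n) k ⧸ I))
              ∩ (qPiece I (a' + i) : Set (MvPolynomial (Fin n) k ⧸ I))} a) := by
  classical
  have hex : ∀ j, ∃ f : MvPolynomial (Fin n) k, j ≤ t →
      f ∈ sPiece k n 1 ∧ Ideal.Quotient.mk I f = z j := by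
    intro j
    by_cases hj : j ≤ t
    · obtain ⟨f, hf, hfz⟩ := mem_qPiece.1 (hlin j hj)
      exact ⟨f, fun _ => ⟨hf, hfz⟩⟩
    · exact ⟨0, fun h => absurd h hj⟩
  choose l hl using hex
  have hmem : ∀ i ≤ t, ∀ f, Ideal.Quotient.mk I f ∈ Ideal.span {x | ∃ j < i, x = z j} ↔
      f ∈ Jc I l i := fun i hi f => mem_Jc I l z i (fun j hj => (hl j (by omega)).2) f
  have hhom : ∀ i ≤ t, IsHomog (Jc I l i) := by
    intro i
    induction i with
    | zero => intro _; exact hI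
    | succ i ih => intro hi; exact isHomog_sup (ih (by omega)) (hl i (by omega)).1
  have htor : ∀ i ≤ t, ∃ N, TorN (Jc I l i) (l i) N := by
    intro i hi
    obtain ⟨N, hN⟩ := filter_torsion (maxIdealQ I) _ (z i) (hfr i (by omega))
    refine ⟨N, fun f hf p hp => ?_⟩
    rw [← hmem i hi, map_mul] at hf ⊢
    rw [(hl i hi).2] at hf
    refine hN _ hf _ ?_
    unfold maxIdealQ
    rw [← Ideal.map_pow]
    exact Ideal.mem_map_of_mem _ hp
  have hup : ∀ i j d, j + i ≤ t → ¬ Van (Jc I l j) i d →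
      ∃ d' ≥ d + i, ¬ Van (Jc I l (j + i)) 0 d' := by
    intro i
    induction i with
    | zero => intro j d _ h; exact ⟨d, by simp, h⟩
    | succ i ih =>
      intro j d hij h
      obtain ⟨N, hN⟩ := htor j (by omega)
      have : ∃ d' ≥ d + 1, ¬ Van (Jc I l (j + 1)) i d' := by
        by_contra! hcon
        exact h (van_up (hhom j (by omega)) (hl j (by omega)).1 hN hcon)
      obtain ⟨d', hd', h'⟩ := this
      obtain ⟨d'', hd'', h''⟩ := ih (j + 1) d' (by omega) h'
      refine ⟨d'', by push_cast; omega, ?_⟩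
      rw [show j + (i + 1) = j + 1 + i by ring]
      exact h''
  have hdown : ∀ j i d, j ≤ t → ¬ Van (Jc I l j) i d →
      ∃ m ≤ j, ¬ Van I (i + m) (d - m) := by
    intro j
    induction j with
    | zero => intro i d _ h; exact ⟨0, le_rfl, by simpa [Jc] using h⟩
    | succ j ih =>
      intro i d hj h
      obtain ⟨N, hN⟩ := htor j (by omega)
      by_cases h1 : Van (Jc I l j) i d
      · by_cases h2 : Van (Jc I l j) (i + 1) (d - 1)
        · exact absurd (van_down (hhom j (by omega)) (hl j (by omega)).1 hN h1 h2) h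
        · obtain ⟨m, hm, hm'⟩ := ih _ _ (by omega) h2
          refine ⟨m + 1, by omega, ?_⟩
          rw [show i + (m + 1) = i + 1 + m by ring,
            show d - ((m + 1 : ℕ) : ℤ) = d - 1 - m by push_cast; ring]
          exact hm'
      · obtain ⟨m, hm, hm'⟩ := ih _ _ (by omega) h1
        exact ⟨m, by omega, hm'⟩
  have hCup : ∀ i ≤ t, ∀ d, ¬ Van I i d → ∃ d' ≥ d + i, d' ∈ CSet (Jc I l i) (l i) := by
    intro i hi d h
    obtain ⟨d', hd', h'⟩ := hup i 0 d (by omega) h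
    rw [zero_add] at h'
    obtain ⟨d'', hd'', h''⟩ := lc_to_cset (hl i hi).1 h'
    exact ⟨d'', by omega, h''⟩
  have hCdown : ∀ i ≤ t, ∀ d, d ∈ CSet (Jc I l i) (l i) → ∃ m ≤ i, ¬ Van I m (d - m) := by
    intro i hi d h
    obtain ⟨N, hN⟩ := htor i hi
    obtain ⟨m, hm, hm'⟩ := hdown i 0 d hi (cset_to_lc hN h)
    exact ⟨m, hm, by simpa using hm'⟩
  have hbdd : ∀ i ≤ t, BddAbove {d : ℤ | lcNonvanish n (qPiece I) i d} := by
    intro i hi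
    obtain ⟨N, hN⟩ := htor i hi
    obtain ⟨B, hB⟩ := cset_bdd hN
    refine ⟨B, fun d hd => ?_⟩
    obtain ⟨d', hd', h'⟩ := hCup i hi d ((lc_iff I i d).1 hd)
    have := hB h'
    omega
  have hcol : ∀ i ≤ t, ∀ e : ℤ,
      ((((Ideal.span {x | ∃ j < i, x = z j}).colon (Ideal.span {z i}) :
              Ideal (MvPolynomial (Fin n) k ⧸ I)) : Set (MvPolynomial (Fin n) k ⧸ I))
              ∩ (qPiece I e : Set (MvPolynomial (Fin n) k ⧸ I)) ≠
          ((Ideal.span {x | ∃ j < i, x = z j} :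
              Ideal (MvPolynomial (Fin n) k ⧸ I)) : Set (MvPolynomial (Fin n) k ⧸ I))
              ∩ (qPiece I e : Set (MvPolynomial (Fin n) k ⧸ I))) ↔
        e ∈ CSet (Jc I l i) (l i) := by
    intro i hi e
    have hc : ∀ f, Ideal.Quotient.mk I f ∈
        (Ideal.span {x | ∃ j < i, x = z j}).colon (Ideal.span {z i}) ↔ l i * f ∈ Jc I l i := by
      intro f
      rw [← hmem i hi, map_mul, (hl i hi).2, mul_comm]
      exact Submodule.mem_colon_span_singleton
    constructor
    · intro hne
      by_contra hnot
      apply hne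
      ext q
      constructor
      · rintro ⟨hq, hqe⟩
        refine ⟨?_, hqe⟩
        obtain ⟨f, hf, rfl⟩ := mem_qPiece.1 hqe
        by_contra hfn
        exact hnot ⟨f, hf, (hc f).1 hq, fun h => hfn ((hmem i hi f).2 h)⟩
      · rintro ⟨hq, hqe⟩
        exact ⟨Ideal.le_colon hq, hqe⟩
    · rintro ⟨f, hf, hlf, hfn⟩ heq
      have : Ideal.Quotient.mk I f ∈ _ := heq.subset ⟨(hc f).2 hlf, mk_mem_qPiece hf⟩
      exact hfn ((hmem i hi f).1 this.1)
  refine ⟨fun r => ?_, fun a => ?_⟩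
  · unfold regT
    rw [sup_iff (qPiece I) t (fun i => (i : ℤ)) hbdd r]
    have h1 : ∀ a ∈ {r' : ℤ | ∃ i ≤ t, lcNonvanish n (qPiece I) i (r' - i)},
        ∃ c ∈ {r' : ℤ | ∃ i ≤ t, r' ∈ CSet (Jc I l i) (l i)}, a ≤ c := by
      rintro a ⟨i, hi, h⟩
      obtain ⟨d', hd', h'⟩ := hCup i hi _ ((lc_iff I _ _).1 h)
      exact ⟨d', ⟨i, hi, h'⟩, by omega⟩
    have h2 : ∀ c ∈ {r' : ℤ | ∃ i ≤ t, r' ∈ CSet (Jc I l i) (l i)},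
        ∃ a ∈ {r' : ℤ | ∃ i ≤ t, lcNonvanish n (qPiece I) i (r' - i)}, c ≤ a := by
      rintro c ⟨i, hi, h⟩
      obtain ⟨m, hm, h'⟩ := hCdown i hi _ h
      exact ⟨c, ⟨m, by omega, (lc_iff I _ _).2 h'⟩, le_rfl⟩
    have hset : {r' : ℤ | ∃ i ≤ t, r' ∈ CSet (Jc I l i) (l i)} = _ :=
      Set.ext fun r' => exists_congr fun i => and_congr_right fun hi => (hcol i hi r').symm
    exact hset ▸ ⟨isGreatest_of_dom h1 h2, isGreatest_of_dom h2 h1⟩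
  · have hs := sup_iff (qPiece I) t (fun _ => (0 : ℤ)) hbdd a
    simp only [WithBot.coe_zero, add_zero, sub_zero] at hs
    unfold aStarT
    rw [hs]
    have h1 : ∀ a ∈ {r' : ℤ | ∃ i ≤ t, lcNonvanish n (qPiece I) i r'},
        ∃ c ∈ {r' : ℤ | ∃ i ≤ t, r' + (i : ℤ) ∈ CSet (Jc I l i) (l i)}, a ≤ c := by
      rintro a ⟨i, hi, h⟩
      obtain ⟨d', hd', h'⟩ := hCup i hi _ ((lc_iff I _ _).1 h)
      exact ⟨d' - i, ⟨i, hi, by rwa [sub_add_cancel]⟩, by omega⟩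
    have h2 : ∀ c ∈ {r' : ℤ | ∃ i ≤ t, r' + (i : ℤ) ∈ CSet (Jc I l i) (l i)},
        ∃ a ∈ {r' : ℤ | ∃ i ≤ t, lcNonvanish n (qPiece I) i r'}, c ≤ a := by
      rintro c ⟨i, hi, h⟩
      obtain ⟨m, hm, h'⟩ := hCdown i hi _ h
      exact ⟨c + i - m, ⟨m, by omega, (lc_iff I _ _).2 h'⟩, by omega⟩
    have hset : {r' : ℤ | ∃ i ≤ t, r' + (i : ℤ) ∈ CSet (Jc I l i) (l i)} = _ :=
      Set.ext fun r' => exists_congr fun i => and_congr_right fun hi => (hcol i hi _).symm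
    exact hset ▸ ⟨isGreatest_of_dom h1 h2, isGreatest_of_dom h2 h1⟩
end
end Paper
end

section
/- Let I be a homogeneous ideal of S = k[x_1,…,x_n] and let in(I) denote the initial ideal of I with respect to the reverse lexicographic term order. Then for each i with 1 ≤ i ≤ n and every integer m ≥ 0, the degree-m graded pieces satisfy [(I, x_n,…,x_{i+1}) : x_i]_m = (I, x_n,…,x_{i+1})_m if and only if [(in(I), x_n,…,x_{i+1}) : x_i]_m = (in(I), x_n,…,x_{i+1})_m. -/
set_option synthInstance.maxHeartbeats 1000000
set_option maxHeartbeats 1000000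

/-! Common definitions: gradings, term orders, initial ideals, generic initial ideals,
Borel-fixed ideals, filter-regular sequences, a Koszul/Čech-type description of graded
local cohomology and the invariants `a_i`, `reg_t`, `a*_t`, minimal graded free
resolutions, and reductions. -/

namespace Paper

open MvPolynomial

noncomputable section

variable {k : Type*} [Field k] {n : ℕ}

/-- Reverse lexicographic comparison (ignoring the degree). -/
def rlt (a b : Fin n →₀ ℕ) : Prop :=
  ∃ i : Fin n, b i < a i ∧ ∀ j : Fin n, i < j → a j = b j

theorem adeg_eq (a : Fin n →₀ ℕ) : adeg a = a.degree := by
  rw [adeg, Finsupp.degree_eq_sum]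

theorem rlt_irrefl (a : Fin n →₀ ℕ) : ¬ rlt a a := by
  rintro ⟨i, h, _⟩
  exact lt_irrefl _ h

theorem rlt_trans {a b c : Fin n →₀ ℕ} (h1 : rlt a b) (h2 : rlt b c) : rlt a c := by
  obtain ⟨i, hi, hi'⟩ := h1
  obtain ⟨j, hj, hj'⟩ := h2
  rcases lt_trichotomy i j with h | h | h
  · refine ⟨j, by rw [hi' j h]; exact hj, fun l hl => ?_⟩
    rw [hi' l (h.trans hl), hj' l hl]
  · subst h
    exact ⟨i, hj.trans hi, fun l hl => (hi' l hl).trans (hj' l hl)⟩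
  · refine ⟨i, by rw [← hj' i h]; exact hi, fun l hl => ?_⟩
    rw [hi' l hl, hj' l (h.trans hl)]

theorem rlt_total {a b : Fin n →₀ ℕ} (h : a ≠ b) : rlt a b ∨ rlt b a := by
  have hne : (Finset.univ.filter fun i => a i ≠ b i).Nonempty := by
    by_contra hcon
    rw [Finset.not_nonempty_iff_eq_empty, Finset.filter_eq_empty_iff] at hcon
    apply h
    ext i
    have := hcon (Finset.mem_univ i)
    simpa using this
  have hmem := Finset.max'_mem _ hne
  have hmax := fun j => Finset.le_max' (Finset.univ.filter fun i => a i ≠ b i) j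
  set p := Finset.max' _ hne
  have hp : a p ≠ b p := by simpa using hmem
  have hp' : ∀ j, p < j → a j = b j := by
    intro j hj
    by_contra hcon
    exact absurd (hmax j (by simpa using hcon)) (not_le.mpr hj)
  rcases lt_or_gt_of_ne hp with h | h
  · exact Or.inr ⟨p, h, fun j hj => (hp' j hj).symm⟩
  · exact Or.inl ⟨p, h, hp'⟩

theorem rlt_add_iff {a b c : Fin n →₀ ℕ} : rlt (c + a) (c + b) ↔ rlt a b := by
  simp [rlt]

/-- If `a` has no variable beyond `i` and `b` has one, then `b < a`. -/
theorem rlt_of_tail {i : Fin n} {a b : Fin n →₀ ℕ} (ha : ∀ l, i < l → a l = 0)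
    (hb : ∃ l, i < l ∧ b l ≠ 0) : rlt b a := by
  obtain ⟨l, hl, hbl⟩ := hb
  have hne : b ≠ a := by
    rintro rfl
    exact hbl (ha l hl)
  rcases rlt_total hne with h | ⟨p, hp, hp'⟩
  · exact h
  · exfalso
    rcases lt_or_ge i p with h | h
    · rw [ha p h] at hp
      omega
    · have := hp' l (lt_of_le_of_lt h hl)
      rw [ha l hl] at this
      exact hbl this.symm

theorem drlt_iff_rlt {a b : Fin n →₀ ℕ} (h : a.degree = b.degree) : drlt a b ↔ rlt a b := by
  simp [drlt, rlt, adeg_eq, h]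

/-- Induction along `rlt` in a fixed degree. -/
theorem rlt_wf (m : ℕ) :
    WellFounded fun a b : {a : Fin n →₀ ℕ // a.degree = m} => rlt a.1 b.1 := by
  have hfin : Finite {a : Fin n →₀ ℕ // a.degree = m} := by
    apply Set.Finite.to_subtype
    refine (Set.finite_Iic (Finsupp.equivFunOnFinite.symm fun _ => m)).subset ?_
    intro a ha i
    have ha' : a.degree = m := ha
    rw [← ha']
    exact Finsupp.le_degree i a
  have : IsTrans {a : Fin n →₀ ℕ // a.degree = m} (fun a b => rlt a.1 b.1) :=
    ⟨fun _ _ _ => rlt_trans⟩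
  have : Std.Irrefl (fun a b : {a : Fin n →₀ ℕ // a.degree = m} => rlt a.1 b.1) :=
    ⟨fun a => rlt_irrefl a.1⟩
  exact Finite.wellFounded_of_trans_of_irrefl _

/-- A nonempty finite set of exponents has an `rlt`-largest element. -/
theorem exists_rlt_max (s : Finset (Fin n →₀ ℕ)) (hs : s.Nonempty) :
    ∃ a ∈ s, ∀ b ∈ s, b ≠ a → rlt b a := by
  classical
  induction hs using Finset.Nonempty.cons_induction with
  | singleton a => exact ⟨a, by simp, by simp⟩
  | cons c s hc hs ih =>
    obtain ⟨a, ha, hmax⟩ := ih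
    have hca : c ≠ a := by
      rintro rfl
      exact hc ha
    rcases rlt_total hca with h | h
    · refine ⟨a, by simp [ha], fun b hb hba => ?_⟩
      rcases Finset.mem_cons.mp hb with rfl | hb
      · exact h
      · exact hmax b hb hba
    · refine ⟨c, by simp, fun b hb hbc => ?_⟩
      rcases Finset.mem_cons.mp hb with rfl | hb
      · exact absurd rfl hbc
      · by_cases hba : b = a
        · rw [hba]; exact h
        · exact rlt_trans (hmax b hb hba) h

/-- `a` is the leading exponent of a homogeneous polynomial `g`. -/
def HLead (g : MvPolynomial (Fin n) k) (a : Fin n →₀ ℕ) : Prop :=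
  coeff a g ≠ 0 ∧ ∀ b, coeff b g ≠ 0 → b.degree = a.degree ∧ (b ≠ a → rlt b a)

theorem isHomogeneous_iff_degree {g : MvPolynomial (Fin n) k} {m : ℕ} :
    g.IsHomogeneous m ↔ ∀ b, coeff b g ≠ 0 → b.degree = m := by
  unfold IsHomogeneous IsWeightedHomogeneous
  simp only [Finsupp.degree_eq_weight_one]
  rfl

theorem HLead.mul {g : MvPolynomial (Fin n) k} {a : Fin n →₀ ℕ} (h : HLead g a)
    (c : Fin n →₀ ℕ) : HLead (monomial c 1 * g) (c + a) := by
  refine ⟨by rw [coeff_monomial_mul, one_mul]; exact h.1, fun b hb => ?_⟩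
  rw [coeff_monomial_mul'] at hb
  split_ifs at hb with hcb
  · obtain ⟨d, rfl⟩ := exists_add_of_le hcb
    rw [one_mul, add_tsub_cancel_left] at hb
    obtain ⟨h1, h2⟩ := h.2 d hb
    refine ⟨by simp [h1], fun hne => rlt_add_iff.mpr (h2 ?_)⟩
    rintro rfl
    exact hne rfl
  · exact absurd rfl hb

/-- From a leading exponent of an arbitrary element to one of a homogeneous element. -/
theorem exists_hlead {I : Ideal (MvPolynomial (Fin n) k)} (hI : IsHomog I)
    {f : MvPolynomial (Fin n) k} {a : Fin n →₀ ℕ} (hf : f ∈ I) (h : IsLeadExp drlt f a) :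
    ∃ g ∈ I, HLead g a := by
  refine ⟨homogeneousComponent a.degree f, hI f hf _, ?_, fun b hb => ?_⟩
  · rw [coeff_homogeneousComponent, if_pos rfl]
    exact mem_support_iff.mp h.1
  · rw [coeff_homogeneousComponent] at hb
    split_ifs at hb with hd
    · exact ⟨hd, fun hne => (drlt_iff_rlt hd).mp (h.2 b (mem_support_iff.mpr hb) hne)⟩
    · exact absurd rfl hb

theorem HLead.isLeadExp {g : MvPolynomial (Fin n) k} {a : Fin n →₀ ℕ} (h : HLead g a) :
    IsLeadExp drlt g a := by
  refine ⟨mem_support_iff.mpr h.1, fun b hb hne => ?_⟩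
  obtain ⟨h1, h2⟩ := h.2 b (mem_support_iff.mp hb)
  exact (drlt_iff_rlt h1).mpr (h2 hne)

/-- The ideal generated by the variables beyond `i`. -/
theorem mem_tail_iff {i : Fin n} {f : MvPolynomial (Fin n) k} :
    f ∈ Ideal.span {f : MvPolynomial (Fin n) k | ∃ l : Fin n, i < l ∧ f = X l} ↔
      ∀ b, coeff b f ≠ 0 → ∃ l, i < l ∧ b l ≠ 0 := by
  have : {f : MvPolynomial (Fin n) k | ∃ l : Fin n, i < l ∧ f = X l} =
      X '' {l | i < l} := by
    ext f
    simp [eq_comm]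
  rw [this, mem_ideal_span_X_image]
  simp

theorem mem_inIdeal_iff {I : Ideal (MvPolynomial (Fin n) k)} (hI : IsHomog I)
    {f : MvPolynomial (Fin n) k} :
    f ∈ inIdeal I ↔ ∀ b, coeff b f ≠ 0 → ∃ g ∈ I, HLead g b := by
  have : {m : MvPolynomial (Fin n) k | ∃ f a, f ∈ I ∧ IsLeadExp drlt f a ∧
      m = monomial a (1 : k)} = (fun s => monomial s (1 : k)) '' {a | ∃ g ∈ I, HLead g a} := by
    ext f
    constructor
    · rintro ⟨g, a, hg, ha, rfl⟩
      exact ⟨a, exists_hlead hI hg ha, rfl⟩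
    · rintro ⟨a, ⟨g, hg, ha⟩, rfl⟩
      exact ⟨g, a, hg, ha.isLeadExp, rfl⟩
  rw [inIdeal, inIdealW, this, mem_ideal_span_monomial_image]
  refine forall_congr' fun b => ?_
  rw [mem_support_iff]
  refine imp_congr_right fun _ => ?_
  constructor
  · rintro ⟨a, ⟨g, hg, ha⟩, hab⟩
    obtain ⟨c, rfl⟩ := exists_add_of_le hab
    rw [add_comm]
    exact ⟨_, I.mul_mem_left _ hg, ha.mul c⟩
  · intro h
    exact ⟨b, h, le_rfl⟩

/-- Membership in `(in(I), x_n, …, x_{i+1})`. -/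
theorem mem_inSup_iff {I : Ideal (MvPolynomial (Fin n) k)} (hI : IsHomog I) {i : Fin n}
    {f : MvPolynomial (Fin n) k} :
    f ∈ inIdeal I ⊔ Ideal.span {f : MvPolynomial (Fin n) k | ∃ l : Fin n, i < l ∧ f = X l} ↔
      ∀ b, coeff b f ≠ 0 → (∃ g ∈ I, HLead g b) ∨ ∃ l, i < l ∧ b l ≠ 0 := by
  constructor
  · intro hf b hb
    obtain ⟨u, hu, v, hv, rfl⟩ := Submodule.mem_sup.mp hf
    rw [mem_inIdeal_iff hI] at hu
    rw [mem_tail_iff] at hv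
    rw [coeff_add] at hb
    by_cases h : coeff b u = 0
    · rw [h, zero_add] at hb
      exact Or.inr (hv b hb)
    · exact Or.inl (hu b h)
  · intro h
    rw [f.as_sum]
    refine Ideal.sum_mem _ fun b hb => ?_
    rcases h b (mem_support_iff.mp hb) with h | h
    · refine Ideal.mem_sup_left ((mem_inIdeal_iff hI).mpr fun c hc => ?_)
      rw [coeff_monomial] at hc
      split_ifs at hc with hbc
      · rw [← hbc]; exact h
      · exact absurd rfl hc
    · refine Ideal.mem_sup_right (mem_tail_iff.mpr fun c hc => ?_)
      rw [coeff_monomial] at hc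
      split_ifs at hc with hbc
      · rw [← hbc]; exact h
      · exact absurd rfl hc

/-- Leading exponents of `(I, x_n, …, x_{i+1})` lie in `(in(I), x_n, …, x_{i+1})`. -/
theorem lead_of_mem_sup {I : Ideal (MvPolynomial (Fin n) k)} (hI : IsHomog I) {i : Fin n}
    {f : MvPolynomial (Fin n) k} {a : Fin n →₀ ℕ}
    (hf : f ∈ I ⊔ Ideal.span {f : MvPolynomial (Fin n) k | ∃ l : Fin n, i < l ∧ f = X l})
    (ha : HLead f a) : (∃ g ∈ I, HLead g a) ∨ ∃ l, i < l ∧ a l ≠ 0 := by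
  by_cases hl : ∃ l, i < l ∧ a l ≠ 0
  · exact Or.inr hl
  left
  obtain ⟨u, hu, v, hv, rfl⟩ := Submodule.mem_sup.mp hf
  rw [mem_tail_iff] at hv
  refine ⟨homogeneousComponent a.degree u, hI u hu _, ?_, fun b hb => ?_⟩
  · rw [coeff_homogeneousComponent, if_pos rfl]
    have hva : coeff a v = 0 := by
      by_contra h
      exact hl (hv a h)
    have := ha.1
    rwa [coeff_add, hva, add_zero] at this
  · rw [coeff_homogeneousComponent] at hb
    split_ifs at hb with hd
    · refine ⟨hd, fun hne => ?_⟩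
      by_cases hvb : coeff b v = 0
      · exact (ha.2 b (by rwa [coeff_add, hvb, add_zero])).2 hne
      · refine rlt_of_tail (i := i) (fun l hil => ?_) (hv b hvb)
        by_contra h
        exact hl ⟨l, hil, h⟩
    · exact absurd rfl hb

/-- Conversely. -/
theorem exists_mem_sup {I : Ideal (MvPolynomial (Fin n) k)} {i : Fin n}
    {a : Fin n →₀ ℕ} (ha : (∃ g ∈ I, HLead g a) ∨ ∃ l, i < l ∧ a l ≠ 0) :
    ∃ g ∈ I ⊔ Ideal.span {f : MvPolynomial (Fin n) k | ∃ l : Fin n, i < l ∧ f = X l},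
      HLead g a := by
  rcases ha with ⟨g, hg, h⟩ | h
  · exact ⟨g, Ideal.mem_sup_left hg, h⟩
  · have key : ∀ b, coeff b (monomial a (1 : k)) ≠ 0 → b = a := by
      intro b hb
      rw [coeff_monomial] at hb
      by_contra hne
      rw [if_neg (Ne.symm hne)] at hb
      exact hb rfl
    refine ⟨monomial a 1, Ideal.mem_sup_right (mem_tail_iff.mpr fun b hb => ?_), ?_, ?_⟩
    · rw [key b hb]; exact h
    · simp
    · intro b hb
      rw [key b hb]
      exact ⟨rfl, fun h => absurd rfl h⟩

theorem inter_eq_iff (A : Ideal (MvPolynomial (Fin n) k)) (i : Fin n) (m : ℕ) :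
    (((A.colon (Ideal.span {(X i : MvPolynomial (Fin n) k)}) :
          Ideal (MvPolynomial (Fin n) k)) : Set (MvPolynomial (Fin n) k)) ∩
        (homogeneousSubmodule (Fin n) k m : Set (MvPolynomial (Fin n) k)) =
      (A : Set (MvPolynomial (Fin n) k)) ∩
        (homogeneousSubmodule (Fin n) k m : Set (MvPolynomial (Fin n) k))) ↔
    ∀ f : MvPolynomial (Fin n) k, f.IsHomogeneous m → X i * f ∈ A → f ∈ A := by
  have hc : ∀ f : MvPolynomial (Fin n) k,
      f ∈ A.colon (Ideal.span {(X i : MvPolynomial (Fin n) k)}) ↔ X i * f ∈ A := by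
    intro f
    rw [Submodule.mem_colon]
    constructor
    · intro h
      have := h (X i) (Ideal.subset_span rfl)
      rwa [smul_eq_mul, mul_comm] at this
    · intro h p hp
      obtain ⟨q, rfl⟩ := Ideal.mem_span_singleton'.mp hp
      rw [smul_eq_mul, show f * (q * X i) = q * (X i * f) by ring]
      exact A.mul_mem_left _ h
  constructor
  · intro h f hf hX
    have : f ∈ (A : Set (MvPolynomial (Fin n) k)) ∩
        (homogeneousSubmodule (Fin n) k m : Set (MvPolynomial (Fin n) k)) := by
      rw [← h]
      exact ⟨(hc f).mpr hX, hf⟩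
    exact this.1
  · intro h
    ext f
    constructor
    · rintro ⟨h1, h2⟩
      exact ⟨h f h2 ((hc f).mp h1), h2⟩
    · rintro ⟨h1, h2⟩
      exact ⟨(hc f).mpr (A.mul_mem_left _ h1), h2⟩

theorem coeff_X_mul_ne {i : Fin n} {f : MvPolynomial (Fin n) k} {b : Fin n →₀ ℕ}
    (hb : coeff b (X i * f) ≠ 0) : ∃ c, b = Finsupp.single i 1 + c ∧ coeff c f ≠ 0 := by
  have : X i * f = monomial (Finsupp.single i 1) 1 * f := rfl
  rw [this, coeff_monomial_mul'] at hb
  split_ifs at hb with h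
  · obtain ⟨d, rfl⟩ := exists_add_of_le h
    rw [one_mul, add_tsub_cancel_left] at hb
    exact ⟨d, rfl, hb⟩
  · exact absurd rfl hb

theorem forward {I : Ideal (MvPolynomial (Fin n) k)} (hI : IsHomog I) (i : Fin n) (m : ℕ)
    (h : ∀ f : MvPolynomial (Fin n) k, f.IsHomogeneous m →
      X i * f ∈ I ⊔ Ideal.span {f | ∃ l : Fin n, i < l ∧ f = X l} →
      f ∈ I ⊔ Ideal.span {f | ∃ l : Fin n, i < l ∧ f = X l}) :
    ∀ f : MvPolynomial (Fin n) k, f.IsHomogeneous m →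
      X i * f ∈ inIdeal I ⊔ Ideal.span {f | ∃ l : Fin n, i < l ∧ f = X l} →
      f ∈ inIdeal I ⊔ Ideal.span {f | ∃ l : Fin n, i < l ∧ f = X l} := by
  intro f hf hX
  rw [mem_inSup_iff hI] at hX ⊢
  intro a ha
  have hdeg := isHomogeneous_iff_degree.mp hf a ha
  rcases hX (Finsupp.single i 1 + a) (by rwa [coeff_X_mul]) with ⟨g, hg, hlead⟩ | ⟨l, hl, hal⟩
  swap
  · right
    refine ⟨l, hl, ?_⟩
    simpa [Finsupp.single_apply, hl.ne] using hal
  set q : MvPolynomial (Fin n) k := divMonomial g (Finsupp.single i 1) with hq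
  have hqc : ∀ c, coeff c q = coeff (Finsupp.single i 1 + c) g := fun c => by
    rw [hq, coeff_divMonomial]
  have hql : HLead q a := by
    refine ⟨by rw [hqc]; exact hlead.1, fun b hb => ?_⟩
    rw [hqc] at hb
    obtain ⟨h1, h2⟩ := hlead.2 _ hb
    refine ⟨by simpa using h1, fun hne => rlt_add_iff.mp (h2 fun h => hne (add_left_cancel h))⟩
  refine lead_of_mem_sup hI (h q ?_ ?_) hql
  · exact isHomogeneous_iff_degree.mpr fun b hb => (hql.2 b hb).1.trans hdeg
  · have : X i * q = g + (X i * q - g) := by ring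
    rw [this]
    refine Ideal.add_mem _ (Ideal.mem_sup_left hg) (Ideal.mem_sup_right ?_)
    refine mem_tail_iff.mpr fun b hb => ?_
    by_cases hbi : Finsupp.single i 1 ≤ b
    · obtain ⟨d, rfl⟩ := exists_add_of_le hbi
      rw [coeff_sub, coeff_X_mul, hqc, sub_self] at hb
      exact absurd rfl hb
    · have hbi0 : b i = 0 := by
        by_contra hne
        exact hbi (Finsupp.single_le_iff.mpr (Nat.one_le_iff_ne_zero.mpr hne))
      have h0 : coeff b (X i * q) = 0 := by
        by_contra hne
        obtain ⟨c, rfl, _⟩ := coeff_X_mul_ne hne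
        exact hbi le_self_add
      rw [coeff_sub, h0, zero_sub, neg_ne_zero] at hb
      have hne : b ≠ Finsupp.single i 1 + a := by
        rintro rfl
        exact hbi le_self_add
      obtain ⟨p, hp, hp'⟩ := (hlead.2 b hb).2 hne
      rcases lt_trichotomy i p with hip | hip | hip
      · exact ⟨p, hip, by omega⟩
      · subst hip
        omega
      · have := hp' i hip
        simp [hbi0] at this
        omega

theorem backward {I : Ideal (MvPolynomial (Fin n) k)} (hI : IsHomog I) (i : Fin n) (m : ℕ)
    (h : ∀ f : MvPolynomial (Fin n) k, f.IsHomogeneous m →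
      X i * f ∈ inIdeal I ⊔ Ideal.span {f | ∃ l : Fin n, i < l ∧ f = X l} →
      f ∈ inIdeal I ⊔ Ideal.span {f | ∃ l : Fin n, i < l ∧ f = X l}) :
    ∀ f : MvPolynomial (Fin n) k, f.IsHomogeneous m →
      X i * f ∈ I ⊔ Ideal.span {f | ∃ l : Fin n, i < l ∧ f = X l} →
      f ∈ I ⊔ Ideal.span {f | ∃ l : Fin n, i < l ∧ f = X l} := by
  have lead : ∀ f : MvPolynomial (Fin n) k, f.IsHomogeneous m → f ≠ 0 → ∃ a, HLead f a := by
    intro f hf h0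
    obtain ⟨a, ha, hmax⟩ := exists_rlt_max f.support (by simpa using h0)
    rw [mem_support_iff] at ha
    refine ⟨a, ha, fun b hb => ⟨?_, hmax b (mem_support_iff.mpr hb)⟩⟩
    rw [isHomogeneous_iff_degree.mp hf b hb, isHomogeneous_iff_degree.mp hf a ha]
  have main : ∀ a : {a : Fin n →₀ ℕ // a.degree = m}, ∀ f : MvPolynomial (Fin n) k,
      f.IsHomogeneous m → X i * f ∈ I ⊔ Ideal.span {f | ∃ l : Fin n, i < l ∧ f = X l} →
      HLead f a.1 → f ∈ I ⊔ Ideal.span {f | ∃ l : Fin n, i < l ∧ f = X l} := by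
    intro a
    induction a using (rlt_wf (n := n) m).induction with
    | _ a ih =>
    intro f hf hX ha
    have hXl : HLead (X i * f) (Finsupp.single i 1 + a.1) := ha.mul _
    have hlead := lead_of_mem_sup hI hX hXl
    have hmon : (monomial a.1 (1 : k)) ∈
        inIdeal I ⊔ Ideal.span {f | ∃ l : Fin n, i < l ∧ f = X l} := by
      refine h _ ?_ ?_
      · exact isHomogeneous_monomial _ a.2
      · refine (mem_inSup_iff hI).mpr fun b hb => ?_
        obtain ⟨c, rfl, hc⟩ := coeff_X_mul_ne hb
        rw [coeff_monomial] at hc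
        split_ifs at hc with hac
        · rw [← hac]; exact hlead
        · exact absurd rfl hc
    obtain ⟨g, hg, hgl⟩ := exists_mem_sup ((mem_inSup_iff hI).mp hmon a.1 (by simp))
    have hgh : g.IsHomogeneous m :=
      isHomogeneous_iff_degree.mpr fun b hb => (hgl.2 b hb).1.trans a.2
    set c : k := coeff a.1 f / coeff a.1 g with hc
    have hf' : f = (f - C c * g) + C c * g := by ring
    rw [hf']
    refine Ideal.add_mem _ ?_ (Ideal.mul_mem_left _ _ hg)
    set f' := f - C c * g with hf'd
    by_cases h0 : f' = 0
    · rw [h0]; exact Ideal.zero_mem _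
    have hh : f'.IsHomogeneous m := hf.sub (hgh.C_mul c)
    obtain ⟨a', ha'⟩ := lead f' hh h0
    refine ih ⟨a', isHomogeneous_iff_degree.mp hh _ ha'.1⟩ ?_ f' hh ?_ ha'
    · have h1 := ha'.1
      have hne : a' ≠ a.1 := by
        rintro rfl
        apply h1
        rw [hf'd, coeff_sub, coeff_C_mul, hc, div_mul_cancel₀ _ hgl.1, sub_self]
      by_cases hfa : coeff a' f = 0
      · rw [hf'd, coeff_sub, coeff_C_mul, hfa, zero_sub, neg_ne_zero] at h1
        exact (hgl.2 a' (right_ne_zero_of_mul h1)).2 hne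
      · exact (ha.2 a' hfa).2 hne
    · rw [hf'd, mul_sub]
      exact Ideal.sub_mem _ hX (Ideal.mul_mem_left _ _ (Ideal.mul_mem_left _ _ hg))
  intro f hf hX
  by_cases h0 : f = 0
  · rw [h0]; exact Ideal.zero_mem _
  obtain ⟨a, ha⟩ := lead f hf h0
  exact main ⟨a, isHomogeneous_iff_degree.mp hf a ha.1⟩ f hf hX ha

/-- Lemma 1.2 (Bayer–Stillman): for the reverse lexicographic order, for each `i` and
each degree `m`, `[(I, xₙ, …, x_{i+1}) : xᵢ]_m = (I, xₙ, …, x_{i+1})_m` holds if and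
only if it holds with `I` replaced by `in(I)`. -/
theorem statement1 {k : Type*} [Field k] {n : ℕ}
    (I : Ideal (MvPolynomial (Fin n) k)) (hI : IsHomog I) (i : Fin n) (m : ℕ) :
    ((((I ⊔ Ideal.span {f | ∃ l : Fin n, i < l ∧ f = X l}).colon
          (Ideal.span {(X i : MvPolynomial (Fin n) k)}) :
          Ideal (MvPolynomial (Fin n) k)) : Set (MvPolynomial (Fin n) k)) ∩
        (homogeneousSubmodule (Fin n) k m : Set (MvPolynomial (Fin n) k)) =
      ((I ⊔ Ideal.span {f | ∃ l : Fin n, i < l ∧ f = X l} :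
          Ideal (MvPolynomial (Fin n) k)) : Set (MvPolynomial (Fin n) k)) ∩
        (homogeneousSubmodule (Fin n) k m : Set (MvPolynomial (Fin n) k))) ↔
    ((((inIdeal I ⊔ Ideal.span {f | ∃ l : Fin n, i < l ∧ f = X l}).colon
          (Ideal.span {(X i : MvPolynomial (Fin n) k)}) :
          Ideal (MvPolynomial (Fin n) k)) : Set (MvPolynomial (Fin n) k)) ∩
        (homogeneousSubmodule (Fin n) k m : Set (MvPolynomial (Fin n) k)) =
      ((inIdeal I ⊔ Ideal.span {f | ∃ l : Fin n, i < l ∧ f = X l} :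
          Ideal (MvPolynomial (Fin n) k)) : Set (MvPolynomial (Fin n) k)) ∩
        (homogeneousSubmodule (Fin n) k m : Set (MvPolynomial (Fin n) k))) := by
  rw [inter_eq_iff, inter_eq_iff]
  exact ⟨forward hI i m, backward hI i m⟩
end
end Paper
end

section
/- Let I be a homogeneous ideal of S = k[x_1,…,x_n] and let in(I) be the initial ideal of I with respect to the reverse lexicographic order. If x_n, x_{n−1},…,x_1 is a filter-regular sequence in S/I, then x_n,…,x_1 is also a filter-regular sequence in S/in(I); that is, for each i = n,…,1 the module ((in(I), x_n,…,x_{i+1}) : x_i)/(in(I), x_n,…,x_{i+1}) has finite length. -/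
set_option synthInstance.maxHeartbeats 1000000
set_option maxHeartbeats 1000000

/-! Common definitions: gradings, term orders, initial ideals, generic initial ideals,
Borel-fixed ideals, filter-regular sequences, a Koszul/Čech-type description of graded
local cohomology and the invariants `a_i`, `reg_t`, `a*_t`, minimal graded free
resolutions, and reductions. -/

namespace Paper

open MvPolynomial

noncomputable section

variable {k : Type*} [Field k] {n : ℕ}

/-- the ideal of variables after `i` -/
def VI (k : Type*) [Field k] {n : ℕ} (i : Fin n) : Ideal (MvPolynomial (Fin n) k) :=
  Ideal.span {f | ∃ l : Fin n, i < l ∧ f = X l}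

/-- Elementwise form of filter-regularity. -/
def FCond (J : Ideal (MvPolynomial (Fin n) k)) : Prop :=
  ∀ i : Fin n, ∀ f, X i * f ∈ J ⊔ VI k i →
    ∃ N : ℕ, ∀ g ∈ (maxIdeal k n) ^ N, g * f ∈ J ⊔ VI k i

theorem mem_VI {i : Fin n} {f : MvPolynomial (Fin n) k} :
    f ∈ VI k i ↔ ∀ m ∈ f.support, ∃ l, i < l ∧ m l ≠ 0 := by
  have : {f : MvPolynomial (Fin n) k | ∃ l : Fin n, i < l ∧ f = X l} = X '' {l | i < l} := by
    ext f; simp [eq_comm]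
  rw [VI, this, mem_ideal_span_X_image]; simp

theorem maxIdeal_isMaximal : (maxIdeal k n).IsMaximal := by
  have h : maxIdeal k n = RingHom.ker (constantCoeff : MvPolynomial (Fin n) k →+* k) := by
    ext f
    have := mem_pow_idealOfVars_iff' (σ := Fin n) (R := k) 1 f
    rw [pow_one] at this
    rw [RingHom.mem_ker, maxIdeal, this]
    constructor
    · intro h
      exact h 0 (by simp)
    · intro h x hx
      have : x = 0 := by
        rw [← Finsupp.degree_eq_zero_iff]; omega
      subst this
      exact h
  rw [h]
  exact RingHom.ker_isMaximal_of_surjective _ (fun c => ⟨C c, by simp⟩)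

theorem fin_len (K A : Ideal (MvPolynomial (Fin n) k))
    (h : ∀ f ∈ A, ∃ N : ℕ, ∀ g ∈ (maxIdeal k n) ^ N, g * f ∈ K) :
    IsFiniteLength (MvPolynomial (Fin n) k) (↥A ⧸ (Submodule.comap (Submodule.subtype A) K)) := by
  have hfg : A.FG := A.fg_of_isNoetherianRing
  obtain ⟨s, hs⟩ := hfg
  have hsA : ∀ f ∈ s, f ∈ A := fun f hf => hs ▸ Ideal.subset_span hf
  choose! N hN using h
  set D := s.sup N with hD
  have hu : ∀ g ∈ (maxIdeal k n) ^ D, ∀ f ∈ A, g * f ∈ K := by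
    intro g hg
    have : A ≤ K.colon {g} := by
      rw [← hs]
      refine Ideal.span_le.2 fun f hf => ?_
      have : g * f ∈ K := hN f (hsA f hf) g (Ideal.pow_le_pow_right (Finset.le_sup hf) hg)
      simpa [mul_comm] using this
    intro f hf
    have := this hf
    simpa [mul_comm] using this
  rw [isFiniteLength_iff_isNoetherian_isArtinian]
  refine ⟨inferInstance, ?_⟩
  have htors : Module.IsTorsionBySet (MvPolynomial (Fin n) k)
      (↥A ⧸ (Submodule.comap (Submodule.subtype A) K)) ((maxIdeal k n) ^ D : Ideal _) := by
    rintro x ⟨g, hg⟩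
    obtain ⟨y, rfl⟩ := Submodule.Quotient.mk_surjective _ x
    rw [← Submodule.Quotient.mk_smul, Submodule.Quotient.mk_eq_zero]
    exact hu g hg y y.2
  have hK : Ring.KrullDimLE 0 (MvPolynomial (Fin n) k ⧸ (maxIdeal k n) ^ D) := by
    refine Ring.krullDimLE_zero_iff.mpr fun J prime ↦
      Ideal.isMaximal_of_isIntegral_of_isMaximal_comap
        (R := MvPolynomial (Fin n) k) _ ?_
    have hp := prime.comap (algebraMap (MvPolynomial (Fin n) k) (MvPolynomial (Fin n) k ⧸ (maxIdeal k n) ^ D))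
    have h1 : (maxIdeal k n) ^ D ≤ J.comap (algebraMap (MvPolynomial (Fin n) k)
        (MvPolynomial (Fin n) k ⧸ (maxIdeal k n) ^ D)) := by
      intro x hx
      have : algebraMap (MvPolynomial (Fin n) k)
        (MvPolynomial (Fin n) k ⧸ (maxIdeal k n) ^ D) x = 0 := Ideal.Quotient.eq_zero_iff_mem.2 hx
      rw [Ideal.mem_comap, this]; exact J.zero_mem
    have h2 := Ideal.IsPrime.le_of_pow_le h1
    rw [← maxIdeal_isMaximal.eq_of_le hp.ne_top h2]
    exact maxIdeal_isMaximal
  have hA : IsArtinianRing (MvPolynomial (Fin n) k ⧸ (maxIdeal k n) ^ D) :=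
    IsNoetherianRing.isArtinianRing_of_krullDimLE_zero
  let _ := htors.module
  have : IsScalarTower (MvPolynomial (Fin n) k) (MvPolynomial (Fin n) k ⧸ (maxIdeal k n) ^ D)
    (↥A ⧸ (Submodule.comap (Submodule.subtype A) K)) := htors.isScalarTower
  have : Module.Finite (MvPolynomial (Fin n) k ⧸ (maxIdeal k n) ^ D)
    (↥A ⧸ (Submodule.comap (Submodule.subtype A) K)) :=
    Module.Finite.of_restrictScalars_finite (MvPolynomial (Fin n) k) _ _
  have : IsArtinian (MvPolynomial (Fin n) k ⧸ (maxIdeal k n) ^ D)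
    (↥A ⧸ (Submodule.comap (Submodule.subtype A) K)) := inferInstance
  exact isArtinian_of_surjective_algebraMap (R := MvPolynomial (Fin n) k ⧸ (maxIdeal k n) ^ D)
    Ideal.Quotient.mk_surjective

theorem colon_bot_mk {R : Type*} [CommRing R] (K : Ideal R) (f : R) :
    (⊥ : Submodule R (R ⧸ K)).colon {(Ideal.Quotient.mk K f)} = K.colon {f} := by
  ext g
  rw [Submodule.mem_colon_singleton, Submodule.mem_colon_singleton, Submodule.mem_bot,
    smul_eq_mul, ← Ideal.Quotient.eq_zero_iff_mem, map_mul]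
  rfl

theorem ass_iff {R : Type*} [CommRing R] [IsNoetherianRing R] (m K : Ideal R) (z : R)
    (hm : ∀ p : Ideal R, p ≠ ⊤ → m ≤ p → p = m) :
    (∀ p ∈ associatedPrimes R (R ⧸ K), p ≠ m → z ∉ p) ↔
      ∀ f, z * f ∈ K → ∃ N : ℕ, m ^ N ≤ K.colon {f} := by
  constructor
  · intro h f hf
    refine Ideal.exists_pow_le_of_le_radical_of_fg_radical ?_ (Ideal.fg_of_isNoetherianRing _)
    rw [← Ideal.sInf_minimalPrimes]
    refine le_sInf fun p hp => ?_
    have hz : z ∈ p := hp.1.2 (by simpa using hf)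
    have hpa : p ∈ associatedPrimes R (R ⧸ K) := by
      rw [AssociatedPrimes.mem_iff, isAssociatedPrime_iff]
      refine ⟨hp.1.1, ?_⟩
      obtain ⟨x, hx⟩ := Submodule.exists_eq_colon_of_mem_minimalPrimes hp
      exact ⟨Ideal.Quotient.mk K x, by rw [colon_bot_mk]; exact hx⟩
    by_contra hne
    exact h p hpa (fun e => hne e.ge) hz
  · intro h p hp hne hz
    rw [AssociatedPrimes.mem_iff, isAssociatedPrime_iff] at hp
    obtain ⟨hpp, x, hx⟩ := hp
    obtain ⟨f, rfl⟩ := Ideal.Quotient.mk_surjective x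
    rw [colon_bot_mk] at hx
    rw [hx, Submodule.mem_colon_singleton, smul_eq_mul] at hz
    obtain ⟨N, hN⟩ := h f hz
    rw [← hx] at hN
    exact hne (hm p hpp.ne_top (Ideal.IsPrime.le_of_pow_le hN))

theorem filterRegular_iff (J : Ideal (MvPolynomial (Fin n) k)) :
    FilterRegular (maxIdealQ J) (revVars J) n ↔ FCond J := by
  have hmax : ∀ p : Ideal (MvPolynomial (Fin n) k ⧸ J), p ≠ ⊤ → maxIdealQ J ≤ p →
      p = maxIdealQ J := by
    intro p hp hle
    have h1 : maxIdeal k n ≤ p.comap (Ideal.Quotient.mk J) := Ideal.map_le_iff_le_comap.1 hle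
    have h2 : p.comap (Ideal.Quotient.mk J) ≠ ⊤ := by
      rwa [Ne, Ideal.comap_eq_top_iff]
    rw [maxIdealQ, maxIdeal_isMaximal.eq_of_le h2 h1,
      Ideal.map_comap_of_surjective _ Ideal.Quotient.mk_surjective]
  have key : ∀ i : Fin n, ∀ f : MvPolynomial (Fin n) k,
      Ideal.Quotient.mk J f ∈ Ideal.span {x | ∃ j < n - 1 - (i : ℕ), x = revVars J j} ↔
        f ∈ J ⊔ VI k i := by
    intro i f
    have : Ideal.span {x | ∃ j < n - 1 - (i : ℕ), x = revVars J j} =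
        (VI k i).map (Ideal.Quotient.mk J) := by
      rw [VI, Ideal.map_span]
      congr 1
      ext x
      constructor
      · rintro ⟨j, hj, rfl⟩
        have hjn : j < n := by omega
        refine ⟨X ⟨n - 1 - j, by omega⟩, ⟨⟨n - 1 - j, by omega⟩, ?_, rfl⟩, ?_⟩
        · rw [Fin.lt_def]; simp only; omega
        · rw [revVars, dif_pos hjn]
      · rintro ⟨_, ⟨l, hl, rfl⟩, rfl⟩
        rw [Fin.lt_def] at hl
        refine ⟨n - 1 - l, by omega, ?_⟩
        rw [revVars, dif_pos (by omega)]
        congr 2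
        ext; simp only; omega
    rw [this, ← Ideal.mem_comap, Ideal.comap_map_of_surjective' _ Ideal.Quotient.mk_surjective,
      Ideal.mk_ker, sup_comm]
  have hrv : ∀ i : Fin n, revVars J (n - 1 - (i : ℕ)) = Ideal.Quotient.mk J (X i) := by
    intro i
    rw [revVars, dif_pos (by omega)]
    congr 2
    ext; simp only; omega
  have step : ∀ i : Fin n, (∀ p ∈ associatedPrimes (MvPolynomial (Fin n) k ⧸ J)
      ((MvPolynomial (Fin n) k ⧸ J) ⧸
        Ideal.span {x | ∃ j < n - 1 - (i : ℕ), x = revVars J j}),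
        p ≠ maxIdealQ J → revVars J (n - 1 - (i : ℕ)) ∉ p) ↔
      ∀ f, X i * f ∈ J ⊔ VI k i →
    ∃ N : ℕ, ∀ g ∈ (maxIdeal k n) ^ N, g * f ∈ J ⊔ VI k i := by
    intro i
    rw [ass_iff _ _ _ hmax, Ideal.Quotient.mk_surjective.forall]
    refine forall_congr' fun f => ?_
    rw [hrv, ← map_mul, key]
    refine imp_congr_right fun _ => exists_congr fun N => ?_
    rw [maxIdealQ, ← Ideal.map_pow, Ideal.map_le_iff_le_comap, SetLike.le_def]
    refine forall₂_congr fun g _ => ?_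
    rw [Ideal.mem_comap, Submodule.mem_colon_singleton, smul_eq_mul, ← map_mul, key]
  constructor
  · intro h i
    exact (step i).1 (h _ (by omega))
  · intro h j hj
    obtain ⟨i, rfl⟩ : ∃ i : Fin n, j = n - 1 - (i : ℕ) := ⟨⟨n - 1 - j, by omega⟩, by simp only; omega⟩
    exact (step i).2 (h i)

theorem adeg_add (a b : Fin n →₀ ℕ) : adeg (a + b) = adeg a + adeg b := by
  simp [adeg, Finset.sum_add_distrib]

theorem drlt_add {a b : Fin n →₀ ℕ} (c : Fin n →₀ ℕ) : drlt (c + a) (c + b) ↔ drlt a b := by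
  simp [drlt, adeg_add]

/-- exponents of leading monomials of `I` -/
def LeadSet (I : Ideal (MvPolynomial (Fin n) k)) : Set (Fin n →₀ ℕ) :=
  {a | ∃ f ∈ I, IsLeadExp drlt f a}

theorem inIdeal_sup (I : Ideal (MvPolynomial (Fin n) k)) (i : Fin n) :
    inIdeal I ⊔ VI k i = Ideal.span ((fun a => monomial a (1 : k)) ''
      (LeadSet I ∪ {a | ∃ l, i < l ∧ a = Finsupp.single l 1})) := by
  rw [Set.image_union, Ideal.span_union, inIdeal, inIdealW, VI]
  congr 2
  · ext m
    simp only [LeadSet, Set.mem_image]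
    constructor
    · rintro ⟨f, a, hf, ha, rfl⟩
      exact ⟨a, ⟨f, hf, ha⟩, rfl⟩
    · rintro ⟨a, ⟨f, hf, ha⟩, rfl⟩
      exact ⟨f, a, hf, ha, rfl⟩
  · ext m
    constructor
    · rintro ⟨l, hl, rfl⟩
      exact ⟨_, ⟨l, hl, rfl⟩, rfl⟩
    · rintro ⟨_, ⟨l, hl, rfl⟩, rfl⟩
      exact ⟨l, hl, rfl⟩

theorem mem_inIdeal_sup {I : Ideal (MvPolynomial (Fin n) k)} {i : Fin n}
    {f : MvPolynomial (Fin n) k} :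
    f ∈ inIdeal I ⊔ VI k i ↔
      ∀ a ∈ f.support, (∃ b ∈ LeadSet I, b ≤ a) ∨ ∃ l, i < l ∧ a l ≠ 0 := by
  rw [inIdeal_sup, mem_ideal_span_monomial_image]
  refine forall₂_congr fun a _ => ?_
  constructor
  · rintro ⟨s, hs | ⟨l, hl, rfl⟩, hle⟩
    · exact Or.inl ⟨s, hs, hle⟩
    · refine Or.inr ⟨l, hl, ?_⟩
      have := hle l
      simp at this; omega
  · rintro (⟨b, hb, hle⟩ | ⟨l, hl, h⟩)
    · exact ⟨b, Or.inl hb, hle⟩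
    · refine ⟨_, Or.inr ⟨l, hl, rfl⟩, ?_⟩
      simp; omega

theorem coeff_mono_mul (c b : Fin n →₀ ℕ) (f : MvPolynomial (Fin n) k) :
    coeff (c + b) (monomial c (1 : k) * f) = coeff b f := by
  rw [coeff_monomial_mul]; simp

/-- From a leading exponent below `a`, get a homogeneous element of `I` with leading exponent `a`. -/
theorem exists_homog {I : Ideal (MvPolynomial (Fin n) k)} (hI : IsHomog I)
    {a b : Fin n →₀ ℕ} (hb : b ∈ LeadSet I) (hle : b ≤ a) :
    ∃ g ∈ I, IsLeadExp drlt g a ∧ ∀ c ∈ g.support, adeg c = adeg a := by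
  obtain ⟨f, hf, hlead⟩ := hb
  obtain ⟨c, rfl⟩ := exists_add_of_le hle
  rw [add_comm]
  have hco : ∀ e, coeff e (homogeneousComponent (adeg b) f) =
      if adeg e = adeg b then coeff e f else 0 := by
    intro e
    rw [coeff_homogeneousComponent, adeg_eq e]
  have hsup : ∀ e ∈ (monomial c (1 : k) * homogeneousComponent (adeg b) f).support,
      ∃ e', e = c + e' ∧ adeg e' = adeg b ∧ e' ∈ f.support := by
    intro e he
    rw [mem_support_iff, coeff_monomial_mul'] at he
    split_ifs at he with hc
    · obtain ⟨e', rfl⟩ := exists_add_of_le hc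
      rw [add_tsub_cancel_left, one_mul, hco] at he
      split_ifs at he with h2
      · exact ⟨e', rfl, h2, by rwa [mem_support_iff]⟩
      · exact absurd rfl he
    · exact absurd rfl he
  refine ⟨monomial c 1 * homogeneousComponent (adeg b) f, I.mul_mem_left _ (hI f hf _), ⟨?_, ?_⟩, ?_⟩
  · rw [mem_support_iff, coeff_mono_mul, hco, if_pos rfl]
    exact mem_support_iff.1 hlead.1
  · intro e he hne
    obtain ⟨e', rfl, _, h⟩ := hsup e he
    rw [drlt_add]
    exact hlead.2 e' h (fun h => hne (by rw [h]))
  · intro e he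
    obtain ⟨e', rfl, h, _⟩ := hsup e he
    rw [adeg_add, adeg_add, h]

/-- the core: monomial case -/
theorem core_mono {I : Ideal (MvPolynomial (Fin n) k)} (hI : IsHomog I) (h : FCond I)
    (i : Fin n) (a : Fin n →₀ ℕ) (ha : ∀ l, i < l → a l = 0)
    (hm : ∃ b ∈ LeadSet I, b ≤ Finsupp.single i 1 + a) :
    ∃ N : ℕ, ∀ c : Fin n →₀ ℕ, N ≤ adeg c → (∀ l, i < l → c l = 0) → c + a ∈ LeadSet I := by
  obtain ⟨b, hb, hle⟩ := hm
  obtain ⟨g, hg, hlead, hdeg⟩ := exists_homog hI hb hle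
  set q := g.divMonomial (Finsupp.single i 1) with hq
  have hqco : ∀ e, coeff e q = coeff (Finsupp.single i 1 + e) g := fun e => coeff_divMonomial _ _ _
  have hX : X i * q ∈ I ⊔ VI k i := by
    have hdm := divMonomial_add_modMonomial_single g i
    have : X i * q = g - g.modMonomial (Finsupp.single i 1) := by
      rw [eq_sub_iff_add_eq]; exact hdm
    rw [this]
    refine Ideal.sub_mem _ (Ideal.mem_sup_left hg) (Ideal.mem_sup_right ?_)
    rw [mem_VI]
    intro m hmm
    rw [mem_support_iff] at hmm
    have hnle : ¬ Finsupp.single i 1 ≤ m := fun hle => hmm (coeff_modMonomial_of_le _ hle)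
    rw [coeff_modMonomial_of_not_le _ hnle] at hmm
    have hmi : m i = 0 := by
      by_contra h0
      exact hnle (by simp; omega)
    have hne : m ≠ Finsupp.single i 1 + a := by
      rintro rfl; simp at hmi
    rcases hlead.2 m (mem_support_iff.2 hmm) hne with hlt | ⟨_, j, hj, hj2⟩
    · rw [hdeg m (mem_support_iff.2 hmm)] at hlt
      exact absurd hlt (lt_irrefl _)
    · refine ⟨j, ?_, by omega⟩
      rcases lt_trichotomy i j with hij | hij | hij
      · exact hij
      · subst hij; omega
      · have := hj2 i hij
        simp [hmi] at this
        omega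
  obtain ⟨N, hN⟩ := h i q hX
  refine ⟨N, fun c hc hcl => ?_⟩
  have hcM : monomial c (1 : k) ∈ (maxIdeal k n) ^ N := by
    rw [maxIdeal]
    exact (monomial_mem_pow_idealOfVars_iff N c one_ne_zero).2 (by rwa [← adeg_eq])
  obtain ⟨p, hp, r, hr, hpr⟩ := Submodule.mem_sup.1 (hN _ hcM)
  rw [mem_VI] at hr
  have hrz : ∀ e, (∀ l, i < l → e l = 0) → coeff e r = 0 := by
    intro e he
    by_contra h0
    obtain ⟨l, hl, hl2⟩ := hr e (mem_support_iff.2 h0)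
    exact hl2 (he l hl)
  have hpco : ∀ e, coeff e p + coeff e r = coeff e (monomial c (1 : k) * q) := by
    intro e; rw [← hpr, coeff_add]
  have hco : ∀ e, coeff e (homogeneousComponent (adeg (c + a)) p) =
      if adeg e = adeg (c + a) then coeff e p else 0 := by
    intro e
    rw [coeff_homogeneousComponent, adeg_eq e]
  refine ⟨homogeneousComponent (adeg (c + a)) p, hI p hp _, ?_, ?_⟩
  · have h1 := hpco (c + a)
    rw [hrz _ (fun l hl => by simp [hcl l hl, ha l hl]), add_zero, coeff_mono_mul, hqco] at h1
    rw [mem_support_iff, hco, if_pos rfl, h1]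
    exact mem_support_iff.1 hlead.1
  · intro e he hne
    rw [mem_support_iff, hco] at he
    split_ifs at he with hde
    swap
    · exact absurd rfl he
    by_cases hre : ∃ l, i < l ∧ e l ≠ 0
    · obtain ⟨l, hl, hel⟩ := hre
      right
      refine ⟨hde, ?_⟩
      -- the largest index where `e` is nonzero
      obtain ⟨j, hj, hjmax⟩ : ∃ j ∈ e.support, ∀ j' ∈ e.support, j' ≤ j :=
        e.support.exists_max_image id ⟨l, by simpa using hel⟩
      have hij : i < j := lt_of_lt_of_le hl (hjmax l (by simpa using hel))
      refine ⟨j, ?_, ?_⟩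
      · have : e j ≠ 0 := by simpa using hj
        simp [hcl j hij, ha j hij]; omega
      · intro j' hj'
        have : e j' = 0 := by
          by_contra h0
          exact absurd (hjmax j' (by simpa using h0)) (not_le.2 hj')
        simp [this, hcl j' (hij.trans hj'), ha j' (hij.trans hj')]
    · push Not at hre
      have h1 := hpco e
      rw [hrz e hre, add_zero] at h1
      rw [h1, coeff_monomial_mul'] at he
      split_ifs at he with hce
      · obtain ⟨e', rfl⟩ := exists_add_of_le hce
        rw [add_tsub_cancel_left, one_mul, hqco] at he
        rw [drlt_add, ← drlt_add (Finsupp.single i 1)]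
        exact hlead.2 _ (mem_support_iff.2 he) (fun h => hne (by rw [add_left_cancel h]))
      · exact absurd rfl he

theorem core {I : Ideal (MvPolynomial (Fin n) k)} (hI : IsHomog I) (h : FCond I) :
    FCond (inIdeal I) := by
  intro i f hf
  rw [mem_inIdeal_sup] at hf
  have hex : ∀ a ∈ f.support, ∃ N : ℕ, ∀ c : Fin n →₀ ℕ, N ≤ adeg c →
      (∃ b ∈ LeadSet I, b ≤ c + a) ∨ ∃ l, i < l ∧ (c + a) l ≠ 0 := by
    intro a haf
    by_cases ha : ∃ l, i < l ∧ a l ≠ 0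
    · obtain ⟨l, hl, hal⟩ := ha
      exact ⟨0, fun c _ => Or.inr ⟨l, hl, by simp; omega⟩⟩
    push Not at ha
    have hs : Finsupp.single i 1 + a ∈ (X i * f).support := by
      rw [mem_support_iff, coeff_X_mul]
      exact mem_support_iff.1 haf
    have hm := (hf _ hs).resolve_right (by
      rintro ⟨l, hl, h0⟩
      apply h0
      simp [ha l hl, hl.ne])
    obtain ⟨N, hN⟩ := core_mono hI h i a ha hm
    refine ⟨N, fun c hc => ?_⟩
    by_cases hcl : ∃ l, i < l ∧ c l ≠ 0
    · obtain ⟨l, hl, hal⟩ := hcl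
      exact Or.inr ⟨l, hl, by simp; omega⟩
    push Not at hcl
    exact Or.inl ⟨_, hN c hc hcl, le_rfl⟩
  choose! N hN using hex
  refine ⟨f.support.sup N, fun g hg => ?_⟩
  rw [mem_inIdeal_sup]
  intro e he
  classical
  obtain ⟨c, hc, a, ha, rfl⟩ := Finset.mem_add.1 (support_mul g f he)
  rw [maxIdeal] at hg
  have := (mem_pow_idealOfVars_iff _ g).1 hg c hc
  rw [← adeg_eq] at this
  exact hN a ha c ((Finset.le_sup ha).trans this)

/-- (Part of proof of Theorem 1.3): if `xₙ, …, x₁` is a filter-regular sequence in `S/I`,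
then it is also a filter-regular sequence in `S/in(I)` for the reverse lexicographic
order; that is, each module `((in I, xₙ, …, x_{i+1}) : xᵢ) / (in I, xₙ, …, x_{i+1})`
has finite length. -/
theorem statement2 {k : Type*} [Field k] {n : ℕ}
    (I : Ideal (MvPolynomial (Fin n) k)) (hI : IsHomog I)
    (hfr : FilterRegular (maxIdealQ I) (revVars I) n) :
    FilterRegular (maxIdealQ (inIdeal I)) (revVars (inIdeal I)) n ∧
    ∀ i : Fin n,
      IsFiniteLength (MvPolynomial (Fin n) k)
        (↥((inIdeal I ⊔ Ideal.span {f | ∃ l : Fin n, i < l ∧ f = X l}).colon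
              (Ideal.span {(X i : MvPolynomial (Fin n) k)})) ⧸
          (Submodule.comap
            (Submodule.subtype
              ((inIdeal I ⊔ Ideal.span {f | ∃ l : Fin n, i < l ∧ f = X l}).colon
                (Ideal.span {(X i : MvPolynomial (Fin n) k)})))
            (inIdeal I ⊔ Ideal.span {f | ∃ l : Fin n, i < l ∧ f = X l}))) := by
  rw [filterRegular_iff] at hfr
  have h := core hI hfr
  refine ⟨(filterRegular_iff _).2 h, fun i => fin_len _ _ fun f hf => h i f ?_⟩
  rw [Ideal.colon_span, Submodule.mem_colon_singleton, smul_eq_mul, mul_comm] at hf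
  exact hf
end
end Paper
end
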